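/- Fix 0 < s ≤ 1 and α > s. For each n let X_n be an ⌊n^s⌋ × n random matrix with i.i.d. standard Gaussian entries, set A_n = X_n X_nᵀ / n, and let B_n be the entrywise matrix |A_n(i,j)|^α. Then there exists ε_s > 0 such that P(λ_min(B_n) ≥ ε_s) → 1 as n → ∞; in particular B_n is positive definite with high probability. -/

import Mathlib

open MeasureTheory ProbabilityTheory Filter Finset
open scoped Matrix

theorem Matrix.PosSemidef.exists_dotProduct_pow_mulVec_eq_sum {ι : Type*} [Fintype ι]
    [DecidableEq ι] {A : Matrix ι ι ℝ} (hA : A.PosSemidef) (b : ι → ℝ) :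
    ∃ l d : ι → ℝ, (∀ i, 0 ≤ l i) ∧ (∀ i, 0 ≤ d i) ∧
      ∀ k : ℕ, b ⬝ᵥ (A ^ k *ᵥ b) = ∑ i, l i ^ k * d i := by
  have hH := hA.isHermitian
  set U : Matrix ι ι ℝ := (hH.eigenvectorUnitary : Matrix ι ι ℝ) with hU
  have hUU : star U * U = 1 := by
    simp [hU]
  have hs : A = U * Matrix.diagonal hH.eigenvalues * star U := by
    have := hH.spectral_theorem
    simpa [Unitary.conjStarAlgAut_apply, hU] using this
  refine ⟨hH.eigenvalues, fun i => (star U *ᵥ b) i ^ 2, hA.eigenvalues_nonneg,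
    fun i => sq_nonneg _, fun k => ?_⟩
  have hpow : A ^ k = U * Matrix.diagonal (hH.eigenvalues ^ k) * star U := by
    have hUU' : U * star U = 1 := by simp [hU]
    induction k with
    | zero => simp [hUU']
    | succ k ih =>
      rw [pow_succ, ih]
      nth_rewrite 2 [hs]
      calc _ = U * Matrix.diagonal (hH.eigenvalues ^ k) * (star U * U)
            * Matrix.diagonal hH.eigenvalues * star U := by simp only [Matrix.mul_assoc]
        _ = _ := by
          rw [hUU, Matrix.mul_one, Matrix.mul_assoc U, Matrix.diagonal_mul_diagonal]
          congr 3
  rw [hpow, ← Matrix.mulVec_mulVec, ← Matrix.mulVec_mulVec, Matrix.dotProduct_mulVec]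
  have : b ᵥ* U = star U *ᵥ b := by
    rw [Matrix.star_eq_conjTranspose, Matrix.conjTranspose_eq_transpose_of_trivial,
      Matrix.mulVec_transpose]
  rw [this]
  simp only [dotProduct, Matrix.mulVec_diagonal, Pi.pow_apply]
  refine Finset.sum_congr rfl fun i _ => by ring

/-- Interpolation of the moments `b ⬝ A ^ k b`. -/
theorem Matrix.PosSemidef.dotProduct_pow_mulVec_le {ι : Type*} [Fintype ι] [DecidableEq ι]
    {A : Matrix ι ι ℝ} (hA : A.PosSemidef) (b : ι → ℝ) {t : ℝ} (ht : 0 < t) {k q : ℕ}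
    (hkq : k ≤ q) :
    b ⬝ᵥ (A ^ k *ᵥ b) ≤ t ^ k * (b ⬝ᵥ b + b ⬝ᵥ (A ^ q *ᵥ b) / t ^ q) := by
  obtain ⟨l, d, hl, hd, h⟩ := hA.exists_dotProduct_pow_mulVec_eq_sum b
  have h0 := h 0
  simp only [pow_zero, Matrix.one_mulVec, one_mul] at h0
  rw [h k, h q, h0, Finset.sum_div, ← Finset.sum_add_distrib, Finset.mul_sum]
  refine Finset.sum_le_sum fun i _ => ?_
  have key : (l i / t) ^ k ≤ 1 + (l i / t) ^ q := by
    have h0 : 0 ≤ l i / t := div_nonneg (hl i) ht.le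
    rcases le_total (l i / t) 1 with h1 | h1
    · linarith [pow_le_one₀ (n := k) h0 h1, pow_nonneg h0 q]
    · linarith [pow_le_pow_right₀ h1 hkq]
  calc l i ^ k * d i = t ^ k * ((l i / t) ^ k * d i) := by
        rw [div_pow]; field_simp
    _ ≤ t ^ k * ((1 + (l i / t) ^ q) * d i) := by
        gcongr
        exact hd i
    _ = _ := by rw [div_pow]; ring

theorem Matrix.PosSemidef.dotProduct_mulVec_pow_le {ι : Type*} [Fintype ι] [DecidableEq ι]
    {A : Matrix ι ι ℝ} (hA : A.PosSemidef) (b : ι → ℝ) (p : ℕ) :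
    (b ⬝ᵥ (A *ᵥ b)) ^ (p + 1) ≤ (b ⬝ᵥ b) ^ p * (b ⬝ᵥ (A ^ (p + 1) *ᵥ b)) := by
  obtain ⟨l, d, hl, hd, h⟩ := hA.exists_dotProduct_pow_mulVec_eq_sum b
  have h0 := h 0
  have h1 := h 1
  simp only [pow_zero, Matrix.one_mulVec, one_mul, pow_one] at h0 h1
  rw [h (p + 1), h0, h1]
  rcases (Finset.sum_nonneg fun i (_ : i ∈ Finset.univ) => hd i).eq_or_lt' with hz | hp
  · have := (Finset.sum_eq_zero_iff_of_nonneg fun i _ => hd i).1 hz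
    simp [this]
  · have := Real.pow_arith_mean_le_arith_mean_pow Finset.univ (fun i => d i / ∑ j, d j) l
      (fun i _ => div_nonneg (hd i) hp.le) (by rw [← Finset.sum_div, div_self hp.ne'])
      (fun i _ => hl i) (p + 1)
    have e1 : ∑ i, d i / (∑ j, d j) * l i = (∑ i, l i * d i) / ∑ j, d j := by
      rw [Finset.sum_div]; exact Finset.sum_congr rfl fun i _ => by ring
    have e2 : ∑ i, d i / (∑ j, d j) * l i ^ (p + 1)
        = (∑ i, l i ^ (p + 1) * d i) / ∑ j, d j := by
      rw [Finset.sum_div]; exact Finset.sum_congr rfl fun i _ => by ring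
    rw [e1, e2, div_pow, div_le_div_iff₀ (by positivity) hp] at this
    have h3 : (∑ i, l i ^ (p + 1) * d i) * (∑ j, d j) ^ (p + 1)
      = ((∑ j, d j) ^ p * ∑ i, l i ^ (p + 1) * d i) * (∑ j, d j) := by ring
    rw [h3] at this
    exact le_of_mul_le_mul_right this hp

theorem Matrix.add_vecMulVec_pow_mulVec {ι : Type*} [Fintype ι] [DecidableEq ι]
    (A : Matrix ι ι ℝ) (r : ι → ℝ) (k : ℕ) :
    (A + Matrix.vecMulVec r r) ^ k *ᵥ r = A ^ k *ᵥ r + ∑ j ∈ Finset.range k,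
      (r ⬝ᵥ ((A + Matrix.vecMulVec r r) ^ (k - 1 - j) *ᵥ r)) • (A ^ j *ᵥ r) := by
  induction k with
  | zero => simp
  | succ k ih =>
    rw [pow_succ', ← Matrix.mulVec_mulVec]
    rw [Matrix.add_mulVec]
    nth_rewrite 1 [ih]
    rw [Matrix.mulVec_add, Matrix.vecMulVec_mulVec, Finset.sum_range_succ']
    simp only [Matrix.mulVec_sum, Matrix.mulVec_smul, Matrix.mulVec_mulVec, ← pow_succ',
      pow_zero, Matrix.one_mulVec]
    simp only [Nat.add_sub_cancel, Nat.sub_zero, op_smul_eq_smul]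
    rw [add_assoc]
    congr 2
    refine Finset.sum_congr rfl fun j _ => ?_
    rw [show k - (j + 1) = k - 1 - j by omega]

theorem Matrix.PosSemidef.dotProduct_add_vecMulVec_pow_le {ι : Type*} [Fintype ι]
    [DecidableEq ι] {A : Matrix ι ι ℝ} (hA : A.PosSemidef) (r : ι → ℝ) (q : ℕ) :
    r ⬝ᵥ ((A + Matrix.vecMulVec r r) ^ q *ᵥ r) ≤
      2 * 3 ^ q * ((r ⬝ᵥ r) ^ (q + 1) + r ⬝ᵥ (A ^ q *ᵥ r)) := by
  have hr0 : 0 ≤ r ⬝ᵥ r := Finset.sum_nonneg fun i _ => mul_self_nonneg _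
  have haq : 0 ≤ r ⬝ᵥ (A ^ q *ᵥ r) := by
    simpa using (hA.pow q).dotProduct_mulVec_nonneg r
  rcases hr0.eq_or_lt' with hz | hpos
  · have : r = 0 := dotProduct_self_eq_zero.1 hz
    subst this
    simp
  rcases Nat.eq_zero_or_pos q with rfl | hq
  · simp only [pow_zero, Matrix.one_mulVec, zero_add, pow_one]; linarith
  set a := r ⬝ᵥ r with ha
  set c := r ⬝ᵥ (A ^ q *ᵥ r) with hc
  set t : ℝ := (a ^ q + c / a) ^ (1 / (q : ℝ)) with ht
  have hca : 0 ≤ c / a := div_nonneg haq hpos.le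
  have htq : t ^ q = a ^ q + c / a := by
    rw [ht, one_div, Real.rpow_inv_natCast_pow (by positivity) hq.ne']
  have htpos : 0 < t := by rw [ht]; positivity
  have hat : a ≤ t := by
    refine le_of_pow_le_pow_left₀ hq.ne' htpos.le ?_
    rw [htq]; linarith
  have hak : ∀ k ≤ q, r ⬝ᵥ (A ^ k *ᵥ r) ≤ 2 * a * t ^ k := fun k hk => by
    have h1 := hA.dotProduct_pow_mulVec_le r htpos hk
    have h2 : c / t ^ q ≤ a := by
      rw [div_le_iff₀ (by positivity), htq]
      have : a * (c / a) = c := by field_simp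
      nlinarith [pow_pos hpos q]
    calc _ ≤ t ^ k * (a + a) := h1.trans (by gcongr)
      _ = _ := by ring
  have hak0 : ∀ k, 0 ≤ r ⬝ᵥ (A ^ k *ᵥ r) := fun k => by
    simpa using (hA.pow k).dotProduct_mulVec_nonneg r
  have hsum : ∀ k : ℕ, ∑ j ∈ Finset.range k, (2 * 3 ^ (k - 1 - j) : ℝ) = 3 ^ k - 1 := fun k => by
    rw [Finset.sum_range_reflect (fun i => (2 * 3 ^ i : ℝ)) k, ← Finset.mul_sum,
      geom_sum_eq (by norm_num)]
    ring
  have hs : ∀ k ≤ q, r ⬝ᵥ ((A + Matrix.vecMulVec r r) ^ k *ᵥ r) ≤ 2 * 3 ^ k * (a * t ^ k) := by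
    intro k
    induction k using Nat.strong_induction_on with
    | _ k ih =>
      intro hk
      rw [Matrix.add_vecMulVec_pow_mulVec, dotProduct_add, dotProduct_sum]
      have hterm : ∀ j ∈ Finset.range k,
          r ⬝ᵥ ((r ⬝ᵥ ((A + Matrix.vecMulVec r r) ^ (k - 1 - j) *ᵥ r)) • (A ^ j *ᵥ r))
            ≤ (2 * 3 ^ (k - 1 - j)) * (2 * a * t ^ k) := by
        intro j hj
        have hj' := Finset.mem_range.1 hj
        rw [dotProduct_smul, smul_eq_mul]
        calc _ ≤ (2 * 3 ^ (k - 1 - j) * (a * t ^ (k - 1 - j))) * (2 * a * t ^ j) := by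
              gcongr
              · exact hak0 j
              · exact ih _ (by omega) (by omega)
              · exact hak j (by omega)
          _ = (2 * 3 ^ (k - 1 - j)) * (2 * a * (a * t ^ (k - 1 - j + j))) := by
              rw [pow_add]; ring
          _ ≤ (2 * 3 ^ (k - 1 - j)) * (2 * a * (t * t ^ (k - 1 - j + j))) := by gcongr
          _ = _ := by
              rw [← pow_succ']
              congr 4
              omega
      have := Finset.sum_le_sum hterm
      rw [← Finset.sum_mul, hsum] at this
      have h3 := hak k hk
      calc _ ≤ 2 * a * t ^ k + (3 ^ k - 1) * (2 * a * t ^ k) := add_le_add h3 this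
        _ = _ := by ring
  calc _ ≤ 2 * 3 ^ q * (a * t ^ q) := hs q le_rfl
    _ = _ := by
      rw [htq]
      field_simp
      ring

theorem Matrix.PosSemidef.exists_eq_transpose_mul_self {ι : Type*} [Fintype ι]
    {M : Matrix ι ι ℝ} (hM : M.PosSemidef) :
    ∃ (m : ℕ) (N : Matrix (Fin m) ι ℝ), M = Nᵀ * N := by
  obtain ⟨m, v, rfl⟩ := Matrix.posSemidef_iff_eq_sum_vecMulVec.1 hM
  refine ⟨m, Matrix.of v, ?_⟩
  ext i j
  simp [Matrix.mul_apply, Matrix.sum_apply, Matrix.vecMulVec_apply]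

theorem Matrix.PosSemidef.dotProduct_mulVec_le_trace {ι : Type*} [Fintype ι] [DecidableEq ι]
    {M : Matrix ι ι ℝ} (hM : M.PosSemidef) (b : ι → ℝ) :
    b ⬝ᵥ (M *ᵥ b) ≤ M.trace * (b ⬝ᵥ b) := by
  obtain ⟨m, N, rfl⟩ := hM.exists_eq_transpose_mul_self
  rw [← Matrix.mulVec_mulVec, Matrix.dotProduct_mulVec, Matrix.vecMul_transpose]
  rw [Matrix.trace_mul_comm]
  simp only [Matrix.trace, Matrix.diag_apply, Matrix.mul_apply, Matrix.transpose_apply]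
  simp only [dotProduct, Matrix.mulVec]
  rw [Finset.sum_mul]
  refine Finset.sum_le_sum fun i _ => ?_
  have := Finset.sum_mul_sq_le_sq_mul_sq Finset.univ (N i) b
  simpa only [sq] using this

theorem Matrix.PosSemidef.sum_mul_le_mul_trace {ι : Type*} [Fintype ι] [DecidableEq ι]
    {M : Matrix ι ι ℝ} (hM : M.PosSemidef) (S : ι → ι → ℝ) {L : ℝ}
    (hS : ∀ w : ι → ℝ, ∑ i, ∑ j, w i * w j * S i j ≤ L * ∑ i, w i ^ 2) :
    ∑ i, ∑ j, S i j * M i j ≤ L * M.trace := by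
  obtain ⟨m, N, rfl⟩ := hM.exists_eq_transpose_mul_self
  have h1 : ∑ i, ∑ j, S i j * (Nᵀ * N) i j = ∑ k, ∑ i, ∑ j, N k i * N k j * S i j := by
    simp only [Matrix.mul_apply, Matrix.transpose_apply, Finset.mul_sum]
    rw [Finset.sum_comm' (s := Finset.univ) (t := fun _ => Finset.univ) (t' := Finset.univ)
      (s' := fun _ => Finset.univ) (by simp)]
    rw [Finset.sum_comm]
    conv_rhs => rw [Finset.sum_comm]
    refine Finset.sum_congr rfl fun i _ => ?_
    rw [Finset.sum_comm]
    refine Finset.sum_congr rfl fun k _ => Finset.sum_congr rfl fun j _ => by ring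
  have h2 : (Nᵀ * N).trace = ∑ k, ∑ i, N k i ^ 2 := by
    rw [Matrix.trace_mul_comm]
    simp only [Matrix.trace, Matrix.diag_apply, Matrix.mul_apply, Matrix.transpose_apply, sq]
  rw [h1, h2, Finset.mul_sum]
  exact Finset.sum_le_sum fun k _ => hS (N k)

/-- Measurable functions bounded by a constant. -/
def BoundedMeasurable {E : Type*} [MeasurableSpace E] (f : E → ℝ) : Prop :=
  Measurable f ∧ ∃ C, ∀ x, |f x| ≤ C

namespace BoundedMeasurable

variable {E F : Type*} [MeasurableSpace E] [MeasurableSpace F] {f g : E → ℝ}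

theorem const (c : ℝ) : BoundedMeasurable fun _ : E => c :=
  ⟨measurable_const, |c|, fun _ => le_rfl⟩

theorem mul (hf : BoundedMeasurable f) (hg : BoundedMeasurable g) :
    BoundedMeasurable fun x => f x * g x := by
  obtain ⟨hf, C, hC⟩ := hf
  obtain ⟨hg, D, hD⟩ := hg
  refine ⟨hf.mul hg, C * D, fun x => ?_⟩
  rw [abs_mul]
  exact mul_le_mul (hC x) (hD x) (abs_nonneg _) ((abs_nonneg _).trans (hC x))

theorem add (hf : BoundedMeasurable f) (hg : BoundedMeasurable g) :
    BoundedMeasurable fun x => f x + g x := by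
  obtain ⟨hf, C, hC⟩ := hf
  obtain ⟨hg, D, hD⟩ := hg
  exact ⟨hf.add hg, C + D, fun x => (abs_add_le _ _).trans (add_le_add (hC x) (hD x))⟩

theorem pow (hf : BoundedMeasurable f) (n : ℕ) : BoundedMeasurable fun x => f x ^ n := by
  induction n with
  | zero => simpa using const 1
  | succ n ih => simpa only [pow_succ] using ih.mul hf

theorem sum {ι : Type*} (s : Finset ι) {f : ι → E → ℝ} (hf : ∀ i, BoundedMeasurable (f i)) :
    BoundedMeasurable fun x => ∑ i ∈ s, f i x := by
  classical
  induction s using Finset.induction_on with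
  | empty => simpa using const 0
  | insert a s ha ih => simpa only [Finset.sum_insert ha] using (hf a).add ih

theorem comp (hf : BoundedMeasurable f) {h : F → E} (hh : Measurable h) :
    BoundedMeasurable fun x => f (h x) :=
  ⟨hf.1.comp hh, hf.2.imp fun _ hC x => hC (h x)⟩

theorem integrable (hf : BoundedMeasurable f) (μ : Measure E) [IsFiniteMeasure μ] :
    Integrable f μ := by
  obtain ⟨hf, C, hC⟩ := hf
  exact Integrable.of_bound hf.aestronglyMeasurable C (ae_of_all _ hC)

theorem matrix_pow {ι : Type*} [Fintype ι] [DecidableEq ι] {M : E → Matrix ι ι ℝ}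
    (hM : ∀ i j, BoundedMeasurable fun x => M x i j) (n : ℕ) (i j : ι) :
    BoundedMeasurable fun x => (M x ^ n) i j := by
  induction n generalizing i j with
  | zero => simpa using const _
  | succ n ih =>
    simp only [pow_succ, Matrix.mul_apply]
    exact sum _ fun k => (ih i k).mul (hM k j)

theorem trace {ι : Type*} [Fintype ι] {M : E → Matrix ι ι ℝ}
    (hM : ∀ i j, BoundedMeasurable fun x => M x i j) :
    BoundedMeasurable fun x => (M x).trace := by
  simp only [Matrix.trace, Matrix.diag_apply]
  exact sum _ fun k => hM k k

theorem dotProduct {ι : Type*} [Fintype ι] {r s : E → ι → ℝ}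
    (hr : ∀ i, BoundedMeasurable fun x => r x i) (hs : ∀ i, BoundedMeasurable fun x => s x i) :
    BoundedMeasurable fun x => r x ⬝ᵥ s x :=
  sum _ fun k => (hr k).mul (hs k)

theorem mulVec {ι : Type*} [Fintype ι] {M : E → Matrix ι ι ℝ} {s : E → ι → ℝ}
    (hM : ∀ i j, BoundedMeasurable fun x => M x i j) (hs : ∀ i, BoundedMeasurable fun x => s x i)
    (i : ι) : BoundedMeasurable fun x => (M x *ᵥ s x) i :=
  sum _ fun k => (hM i k).mul (hs k)

end BoundedMeasurable

/-- Sum of the rank-one matrices `R (x i) R (x i)ᵀ` over `i ∈ F`. -/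
def rowGram {E ι κ : Type*} (R : E → ι → ℝ) (F : Finset κ) (x : κ → E) : Matrix ι ι ℝ :=
  ∑ i ∈ F, Matrix.vecMulVec (R (x i)) (R (x i))

theorem rowGram_posSemidef {E ι κ : Type*} [Fintype ι] (R : E → ι → ℝ) (F : Finset κ)
    (x : κ → E) : (rowGram R F x).PosSemidef :=
  Matrix.posSemidef_sum _ fun i _ => by
    simpa using Matrix.posSemidef_vecMulVec_self_star (R (x i))

theorem BoundedMeasurable.rowGram {E ι κ : Type*} [MeasurableSpace E] {R : E → ι → ℝ}
    (hR : ∀ j, BoundedMeasurable fun x => R x j) (F : Finset κ) (i j : ι) :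
    BoundedMeasurable fun x : κ → E => rowGram R F x i j := by
  simp only [_root_.rowGram, Matrix.sum_apply, Matrix.vecMulVec_apply]
  exact .sum _ fun k => ((hR i).comp (measurable_pi_apply k)).mul
    ((hR j).comp (measurable_pi_apply k))

theorem integral_mul_comp_restrict {E κ : Type*} [MeasurableSpace E] [Fintype κ]
    (γ : Measure E) [IsProbabilityMeasure γ] {i : κ} {F : Finset κ} (hi : i ∉ F) {f : E → ℝ}
    (hf : Measurable f) {h : (F → E) → ℝ} (hh : Measurable h) :
    ∫ x : κ → E, f (x i) * h (fun k : F => x k) ∂Measure.pi (fun _ => γ)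
      = (∫ x, f x ∂γ) * ∫ x : κ → E, h (fun k : F => x k) ∂Measure.pi (fun _ => γ) := by
  classical
  have hind : iIndepFun (fun (k : κ) (x : κ → E) => x k) (Measure.pi (fun _ : κ => γ)) :=
    iIndepFun_pi (X := fun _ => id) fun _ => aemeasurable_id
  have h2 := hind.indepFun_finset {i} F (by simpa using hi) fun k => measurable_pi_apply k
  have h3 := h2.comp (φ := fun y : ({i} : Finset κ) → E => f (y ⟨i, by simp⟩)) (ψ := h)
    (hf.comp (measurable_pi_apply _)) hh
  have hm : Measurable fun x : κ → E => (fun k : F => x k) :=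
    measurable_pi_lambda _ fun k => measurable_pi_apply _
  have := h3.integral_fun_mul_eq_mul_integral
    (hf.comp (measurable_pi_apply i)).aestronglyMeasurable (hh.comp hm).aestronglyMeasurable
  simp only [Function.comp_def] at this
  rw [this, integral_comp_eval (μ := fun _ : κ => γ) (i := i) hf.aestronglyMeasurable]

theorem trace_rowGram_pow_succ_le {E ι κ : Type*} [Fintype ι] [DecidableEq ι] [DecidableEq κ]
    (R : E → ι → ℝ) (F : Finset κ) (x : κ → E) (q : ℕ) :
    (rowGram R F x ^ (q + 1)).trace ≤ ∑ i ∈ F, 2 * 3 ^ q * ((R (x i) ⬝ᵥ R (x i)) ^ (q + 1)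
      + R (x i) ⬝ᵥ (rowGram R (F.erase i) x ^ q *ᵥ R (x i))) := by
  rw [pow_succ']
  nth_rewrite 1 [rowGram]
  rw [Finset.sum_mul, Matrix.trace_sum]
  refine Finset.sum_le_sum fun i hi => ?_
  have h1 : rowGram R F x = rowGram R (F.erase i) x + Matrix.vecMulVec (R (x i)) (R (x i)) := by
    rw [rowGram, rowGram, Finset.sum_erase_add _ _ hi]
  rw [Matrix.vecMulVec_mul, Matrix.trace_vecMulVec, dotProduct_comm, ← Matrix.dotProduct_mulVec,
    h1]
  exact (rowGram_posSemidef R _ x).dotProduct_add_vecMulVec_pow_le _ q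

theorem integral_quadForm_rowGram_pow_le {E ι κ : Type*} [MeasurableSpace E] [Fintype κ]
    [Fintype ι] [DecidableEq ι] [DecidableEq κ] (γ : Measure E) [IsProbabilityMeasure γ]
    {R : E → ι → ℝ} (hR : ∀ j, BoundedMeasurable fun x => R x j) {L : ℝ}
    (hS : ∀ w : ι → ℝ, ∑ i, ∑ j, w i * w j * ∫ x, R x i * R x j ∂γ ≤ L * ∑ i, w i ^ 2)
    {F : Finset κ} {i : κ} (hi : i ∉ F) (q : ℕ) :
    ∫ x : κ → E, R (x i) ⬝ᵥ (rowGram R F x ^ q *ᵥ R (x i)) ∂Measure.pi (fun _ => γ)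
      ≤ L * ∫ x : κ → E, (rowGram R F x ^ q).trace ∂Measure.pi (fun _ => γ) := by
  have hG := fun j k => BoundedMeasurable.matrix_pow (BoundedMeasurable.rowGram (κ := κ) hR F) q j k
  have hRi : ∀ j, BoundedMeasurable fun x : κ → E => R (x i) j := fun j =>
    (hR j).comp (measurable_pi_apply i)
  set h : ι → ι → (F → E) → ℝ := fun j k y =>
    ((∑ a : F, Matrix.vecMulVec (R (y a)) (R (y a))) ^ q) j k with hh
  have hrw : ∀ (x : κ → E) (j k : ι), (rowGram R F x ^ q) j k = h j k (fun a : F => x a) := by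
    intro x j k
    rw [hh, rowGram, ← Finset.sum_coe_sort F]
  have hhm : ∀ j k, Measurable (h j k) := fun j k =>
    (BoundedMeasurable.matrix_pow (M := fun y : F → E =>
      ∑ a : F, Matrix.vecMulVec (R (y a)) (R (y a)))
      (fun j k => BoundedMeasurable.rowGram (κ := F) hR Finset.univ j k) q j k).1
  set T : Matrix ι ι ℝ :=
    Matrix.of fun j k => ∫ x : κ → E, (rowGram R F x ^ q) j k ∂Measure.pi (fun _ => γ) with hT
  have htr : ∫ x : κ → E, (rowGram R F x ^ q).trace ∂Measure.pi (fun _ => γ) = T.trace := by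
    simp only [Matrix.trace, Matrix.diag_apply, hT, Matrix.of_apply]
    exact integral_finsetSum _ fun j _ => (hG j j).integrable _
  have hTpos : T.PosSemidef := by
    refine Matrix.PosSemidef.of_dotProduct_mulVec_nonneg ?_ fun w => ?_
    · ext j k
      simp only [Matrix.conjTranspose_apply, hT, Matrix.of_apply, star_trivial]
      refine integral_congr_ae (ae_of_all _ fun x => ?_)
      simpa using ((rowGram_posSemidef R F x).pow q).isHermitian.apply j k
    · have : star w ⬝ᵥ T *ᵥ w = ∫ x : κ → E, w ⬝ᵥ ((rowGram R F x ^ q) *ᵥ w)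
          ∂Measure.pi (fun _ => γ) := by
        simp only [dotProduct, Matrix.mulVec, hT, Matrix.of_apply, star_trivial, Finset.mul_sum]
        rw [integral_finsetSum _ fun j _ =>
          (BoundedMeasurable.sum _ fun k =>
            (BoundedMeasurable.const _).mul ((hG j k).mul (.const _))).integrable _]
        refine Finset.sum_congr rfl fun j _ => ?_
        rw [integral_finsetSum _ fun k _ =>
            ((BoundedMeasurable.const _).mul ((hG j k).mul (.const _))).integrable _]
        refine Finset.sum_congr rfl fun k _ => ?_
        rw [integral_const_mul, integral_mul_const]
      rw [this]
      refine integral_nonneg fun x => ?_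
      simpa using ((rowGram_posSemidef R F x).pow q).dotProduct_mulVec_nonneg w
  have hmain : ∫ x : κ → E, R (x i) ⬝ᵥ (rowGram R F x ^ q *ᵥ R (x i)) ∂Measure.pi (fun _ => γ)
      = ∑ j, ∑ k, (∫ x, R x j * R x k ∂γ) * T j k := by
    simp only [dotProduct, Matrix.mulVec, Finset.mul_sum]
    rw [integral_finsetSum _ fun j _ =>
      (BoundedMeasurable.sum _ fun k => (hRi j).mul ((hG j k).mul (hRi k))).integrable _]
    refine Finset.sum_congr rfl fun j _ => ?_
    rw [integral_finsetSum _ fun k _ => ((hRi j).mul ((hG j k).mul (hRi k))).integrable _]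
    refine Finset.sum_congr rfl fun k _ => ?_
    simp only [hT, Matrix.of_apply, hrw]
    rw [← integral_mul_comp_restrict γ hi (f := fun x => R x j * R x k) ((hR j).mul (hR k)).1
      (hhm j k)]
    refine integral_congr_ae (ae_of_all _ fun x => ?_)
    simp only
    ring
  rw [htr, hmain]
  exact hTpos.sum_mul_le_mul_trace _ hS

theorem integral_trace_rowGram_pow_le {E ι κ : Type*} [MeasurableSpace E] [Fintype κ]
    [Fintype ι] [DecidableEq ι] [DecidableEq κ] (γ : Measure E) [IsProbabilityMeasure γ]
    {R : E → ι → ℝ} (hR : ∀ j, BoundedMeasurable fun x => R x j) {L : ℝ} (hL : 0 ≤ L)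
    (hS : ∀ w : ι → ℝ, ∑ i, ∑ j, w i * w j * ∫ x, R x i * R x j ∂γ ≤ L * ∑ i, w i ^ 2)
    {M : ℕ → ℝ} (hM : ∀ q, ∫ x, (R x ⬝ᵥ R x) ^ q ∂γ ≤ M q) {a : ℕ → ℝ}
    (ha0 : (Fintype.card ι : ℝ) ≤ a 0)
    (ha : ∀ q, (Fintype.card κ : ℝ) * (2 * 3 ^ q * (M (q + 1) + L * a q)) ≤ a (q + 1))
    (q : ℕ) (F : Finset κ) :
    ∫ x : κ → E, (rowGram R F x ^ q).trace ∂Measure.pi (fun _ => γ) ≤ a q := by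
  induction q generalizing F with
  | zero => simpa using ha0
  | succ q ih =>
    have hRi : ∀ i j, BoundedMeasurable fun x : κ → E => R (x i) j := fun i j =>
      (hR j).comp (measurable_pi_apply i)
    have hG := fun F q j k =>
      BoundedMeasurable.matrix_pow (BoundedMeasurable.rowGram (κ := κ) hR F) q j k
    have h1 := fun i => (BoundedMeasurable.dotProduct (hRi i) (hRi i)).pow (q + 1)
    have h2 := fun i => BoundedMeasurable.dotProduct (hRi i)
      (BoundedMeasurable.mulVec (hG (F.erase i) q) (hRi i))
    have hM0 : 0 ≤ M (q + 1) := (integral_nonneg fun x =>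
      pow_nonneg (Finset.sum_nonneg fun i _ => mul_self_nonneg _) _).trans (hM (q + 1))
    have ha0' : 0 ≤ a q := (integral_nonneg fun x =>
      ((rowGram_posSemidef R ∅ x).pow q).trace_nonneg).trans (ih ∅)
    calc _ ≤ ∫ x : κ → E, ∑ i ∈ F, 2 * 3 ^ q * ((R (x i) ⬝ᵥ R (x i)) ^ (q + 1)
            + R (x i) ⬝ᵥ (rowGram R (F.erase i) x ^ q *ᵥ R (x i))) ∂Measure.pi (fun _ => γ) := by
          refine integral_mono ((BoundedMeasurable.trace (hG F (q + 1))).integrable _)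
            ((BoundedMeasurable.sum _ fun i =>
              (BoundedMeasurable.const _).mul ((h1 i).add (h2 i))).integrable _)
            fun x => trace_rowGram_pow_succ_le R F x q
      _ = ∑ i ∈ F, 2 * 3 ^ q * (∫ x, (R x ⬝ᵥ R x) ^ (q + 1) ∂γ + ∫ x : κ → E,
            R (x i) ⬝ᵥ (rowGram R (F.erase i) x ^ q *ᵥ R (x i)) ∂Measure.pi (fun _ => γ)) := by
          rw [integral_finsetSum _ fun i _ =>
            ((BoundedMeasurable.const _).mul ((h1 i).add (h2 i))).integrable _]
          refine Finset.sum_congr rfl fun i _ => ?_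
          rw [integral_const_mul, integral_add ((h1 i).integrable _) ((h2 i).integrable _),
            integral_comp_eval (μ := fun _ : κ => γ) (i := i)
              (f := fun x => (R x ⬝ᵥ R x) ^ (q + 1))
              ((BoundedMeasurable.dotProduct hR hR).pow (q + 1)).1.aestronglyMeasurable]
      _ ≤ ∑ i ∈ F, 2 * 3 ^ q * (M (q + 1) + L * a q) := by
          gcongr with i hi
          · exact hM _
          · exact (integral_quadForm_rowGram_pow_le γ hR hS (Finset.notMem_erase i F) q).trans
              (mul_le_mul_of_nonneg_left (ih _) hL)
      _ = F.card * (2 * 3 ^ q * (M (q + 1) + L * a q)) := by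
          rw [Finset.sum_const, nsmul_eq_mul]
      _ ≤ Fintype.card κ * (2 * 3 ^ q * (M (q + 1) + L * a q)) := by
          gcongr
          exact Finset.card_le_univ F
      _ ≤ _ := ha q

theorem measurePreserving_piecewise_pi {E κ : Type*} [MeasurableSpace E] [Fintype κ]
    [DecidableEq κ] (γ : Measure E) [IsProbabilityMeasure γ] (I : Finset κ) :
    MeasurePreserving (fun (p : (κ → E) × (κ → E)) (i : κ) => if i ∈ I then p.1 i else p.2 i)
      ((Measure.pi fun _ => γ).prod (Measure.pi fun _ => γ)) (Measure.pi fun _ => γ) := by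
  have hm : Measurable fun (p : (κ → E) × (κ → E)) (i : κ) =>
      if i ∈ I then p.1 i else p.2 i := by
    refine measurable_pi_lambda _ fun i => ?_
    by_cases h : i ∈ I <;> simp only [h, if_true, if_false] <;> fun_prop
  refine ⟨hm, (Measure.pi_eq fun s hs => ?_).symm⟩
  rw [Measure.map_apply hm (MeasurableSet.univ_pi hs)]
  have : (fun (p : (κ → E) × (κ → E)) (i : κ) => if i ∈ I then p.1 i else p.2 i) ⁻¹'
      Set.univ.pi s = (Set.univ.pi fun i => if i ∈ I then s i else Set.univ) ×ˢ
        (Set.univ.pi fun i => if i ∈ I then Set.univ else s i) := by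
    ext p
    simp only [Set.mem_preimage, Set.mem_pi, Set.mem_univ, true_imp_iff, Set.mem_prod,
      ← forall_and]
    refine forall_congr' fun i => ?_
    by_cases h : i ∈ I <;> simp [h]
  rw [this, Measure.prod_prod, Measure.pi_pi, Measure.pi_pi, ← Finset.prod_mul_distrib]
  refine Finset.prod_congr rfl fun i _ => ?_
  by_cases h : i ∈ I <;> simp [h]

/-- The row `(k x (y j))_j` with the columns in `I` set to zero. -/
def offRow {E κ : Type*} [DecidableEq κ] (k : E → E → ℝ) (I : Finset κ) (y : κ → E) (x : E)
    (j : κ) : ℝ :=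
  if j ∈ I then 0 else k x (y j)

/-- The average over `I` of the traces of the `p`-th powers of the Gram matrices of the
off-diagonal blocks with rows in `I` and columns outside of `I`. -/
noncomputable def averageTrace {E κ : Type*} [Fintype κ] [DecidableEq κ] (k : E → E → ℝ) (p : ℕ)
    (z : κ → E) : ℝ :=
  ∑ I : Finset κ, (2 ^ Fintype.card κ : ℝ)⁻¹ * (rowGram (offRow k I z) I z ^ p).trace

theorem averageTrace_nonneg {E κ : Type*} [Fintype κ] [DecidableEq κ] (k : E → E → ℝ) (p : ℕ)
    (z : κ → E) : 0 ≤ averageTrace k p z :=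
  Finset.sum_nonneg fun I _ => mul_nonneg (by positivity)
    ((rowGram_posSemidef _ I z).pow p).trace_nonneg

theorem BoundedMeasurable.offRow {E F κ : Type*} [MeasurableSpace E] [MeasurableSpace F]
    [DecidableEq κ] {k : E → E → ℝ} (hk : BoundedMeasurable fun p : E × E => k p.1 p.2)
    (I : Finset κ) {f : F → κ → E} {g : F → E} (hf : Measurable f) (hg : Measurable g) (j : κ) :
    BoundedMeasurable fun u => offRow k I (f u) (g u) j := by
  unfold _root_.offRow
  by_cases h : j ∈ I
  · simpa only [h, if_true] using .const 0
  · simp only [h, if_false]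
    exact hk.comp (h := fun u => (g u, f u j)) (hg.prodMk ((measurable_pi_apply j).comp hf))

theorem BoundedMeasurable.trace_rowGram_offRow {E F κ : Type*} [MeasurableSpace E]
    [MeasurableSpace F] [Fintype κ]
    [DecidableEq κ] {k : E → E → ℝ} (hk : BoundedMeasurable fun p : E × E => k p.1 p.2)
    (I : Finset κ) {f g : F → κ → E} (hf : Measurable f) (hg : Measurable g) (p : ℕ) :
    BoundedMeasurable fun u => (_root_.rowGram (_root_.offRow k I (f u)) I (g u) ^ p).trace := by
  refine .trace fun a b => .matrix_pow (fun i j => ?_) p a b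
  simp only [_root_.rowGram, Matrix.sum_apply, Matrix.vecMulVec_apply]
  exact .sum _ fun l => (hk.offRow I hf ((measurable_pi_apply l).comp hg) i).mul
    (hk.offRow I hf ((measurable_pi_apply l).comp hg) j)

theorem BoundedMeasurable.averageTrace {E κ : Type*} [MeasurableSpace E] [Fintype κ]
    [DecidableEq κ] {k : E → E → ℝ} (hk : BoundedMeasurable fun p : E × E => k p.1 p.2) (p : ℕ) :
    BoundedMeasurable fun z : κ → E => averageTrace k p z :=
  .sum _ fun I => (BoundedMeasurable.const _).mul
    (hk.trace_rowGram_offRow I measurable_id measurable_id p)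

theorem integral_averageTrace_le {E κ : Type*} [MeasurableSpace E] [Fintype κ]
    [DecidableEq κ] (γ : Measure E) [IsProbabilityMeasure γ] {k : E → E → ℝ}
    (hk : BoundedMeasurable fun p : E × E => k p.1 p.2) (p : ℕ) {B : (κ → E) → ℝ}
    (hB : Integrable B (Measure.pi fun _ => γ))
    (hle : ∀ (I : Finset κ) (y : κ → E),
      ∫ x : κ → E, (rowGram (offRow k I y) I x ^ p).trace ∂Measure.pi (fun _ => γ) ≤ B y) :
    ∫ z : κ → E, averageTrace k p z ∂Measure.pi (fun _ => γ)
      ≤ ∫ y : κ → E, B y ∂Measure.pi (fun _ => γ) := by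
  have hterm : ∀ I : Finset κ,
      ∫ z : κ → E, (rowGram (offRow k I z) I z ^ p).trace ∂Measure.pi (fun _ => γ)
        ≤ ∫ y : κ → E, B y ∂Measure.pi (fun _ => γ) := by
    intro I
    have hmp := measurePreserving_piecewise_pi (κ := κ) γ I
    have hbm : BoundedMeasurable fun z : κ → E => (rowGram (offRow k I z) I z ^ p).trace :=
      hk.trace_rowGram_offRow I measurable_id measurable_id p
    have hbm2 := hk.trace_rowGram_offRow (F := (κ → E) × (κ → E)) I measurable_snd
      measurable_fst p
    have e1 : ∫ z : κ → E, (rowGram (offRow k I z) I z ^ p).trace ∂Measure.pi (fun _ => γ)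
        = ∫ q : (κ → E) × (κ → E), (rowGram (offRow k I q.2) I q.1 ^ p).trace
          ∂((Measure.pi fun _ => γ).prod (Measure.pi fun _ => γ)) := by
      conv_lhs => rw [← hmp.map_eq]
      rw [integral_map hmp.measurable.aemeasurable hbm.1.aestronglyMeasurable]
      refine integral_congr_ae (ae_of_all _ fun q => ?_)
      have h1 : offRow k I (fun i => if i ∈ I then q.1 i else q.2 i) = offRow k I q.2 := by
        ext x j
        by_cases h : j ∈ I <;> simp [offRow, h]
      simp only [h1]
      congr 2
      unfold rowGram
      refine Finset.sum_congr rfl fun i hi => ?_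
      simp only [hi, if_true]
    rw [e1, integral_prod_symm _ (hbm2.integrable _)]
    exact integral_mono (hbm2.integrable _).integral_prod_right hB fun y => hle I y
  have hbm : ∀ I : Finset κ, BoundedMeasurable fun z : κ → E =>
      (2 ^ Fintype.card κ : ℝ)⁻¹ * (rowGram (offRow k I z) I z ^ p).trace := fun I =>
    (BoundedMeasurable.const _).mul (hk.trace_rowGram_offRow I measurable_id measurable_id p)
  calc _ = ∑ I : Finset κ, (2 ^ Fintype.card κ : ℝ)⁻¹ *
        ∫ z : κ → E, (rowGram (offRow k I z) I z ^ p).trace ∂Measure.pi (fun _ => γ) := by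
        unfold averageTrace
        rw [integral_finsetSum _ fun I _ => (hbm I).integrable _]
        simp only [integral_const_mul]
    _ ≤ ∑ I : Finset κ, (2 ^ Fintype.card κ : ℝ)⁻¹ * ∫ y, B y ∂Measure.pi (fun _ => γ) := by
        exact Finset.sum_le_sum fun I _ => mul_le_mul_of_nonneg_left (hterm I) (by positivity)
    _ = _ := by
        rw [Finset.sum_const, Finset.card_univ, Fintype.card_finset, nsmul_eq_mul]
        push_cast
        rw [← mul_assoc, mul_inv_cancel₀ (by positivity), one_mul]

theorem four_mul_card_filter_mem_notMem {κ : Type*} [Fintype κ] [DecidableEq κ] {i j : κ}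
    (hij : i ≠ j) :
    4 * #{I : Finset κ | i ∈ I ∧ j ∉ I} = 2 ^ Fintype.card κ := by
  have h1 : ({I : Finset κ | i ∈ I ∧ j ∉ I} : Finset (Finset κ)) = Finset.Icc {i} {j}ᶜ := by
    ext I
    simp only [Finset.mem_filter, Finset.mem_univ, true_and, Finset.mem_Icc,
      Finset.singleton_subset_iff, Finset.subset_compl_singleton]
  have h2 : 2 ≤ Fintype.card κ := by
    have := Finset.card_le_univ ({i, j} : Finset κ)
    rwa [Finset.card_pair hij] at this
  rw [h1, Finset.card_Icc_finset (by simpa using hij.symm), Finset.card_compl,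
    Finset.card_singleton, Finset.card_singleton]
  obtain ⟨c, hc⟩ := Nat.exists_eq_add_of_le h2
  rw [hc, show 2 + c - 1 - 1 = c by omega, pow_add]
  norm_num

theorem offDiag_sum_eq_average {κ : Type*} [Fintype κ] [DecidableEq κ] (f : κ → κ → ℝ) :
    ∑ i, ∑ j, (if i = j then 0 else f i j) = 4 * ∑ I : Finset κ,
      (2 ^ Fintype.card κ : ℝ)⁻¹ * ∑ i ∈ I, ∑ j, (if j ∈ I then 0 else f i j) := by
  have h1 : ∀ I : Finset κ, ∑ i ∈ I, ∑ j, (if j ∈ I then 0 else f i j)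
      = ∑ i, ∑ j, (if i ∈ I ∧ j ∉ I then f i j else 0) := by
    intro I
    rw [← Finset.sum_filter_add_sum_filter_not Finset.univ (· ∈ I)]
    rw [Finset.sum_eq_zero (s := Finset.univ.filter (· ∉ I))]
    · rw [add_zero, Finset.filter_mem_eq_inter, Finset.univ_inter]
      refine Finset.sum_congr rfl fun i hi => Finset.sum_congr rfl fun j _ => ?_
      by_cases h : j ∈ I <;> simp [h, hi]
    · intro i hi
      simp [(Finset.mem_filter.1 hi).2]
  simp only [h1]
  rw [← Finset.mul_sum, Finset.sum_comm (s := (Finset.univ : Finset (Finset κ)))]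
  have h2 : ∀ i, ∑ I : Finset κ, ∑ j, (if i ∈ I ∧ j ∉ I then f i j else 0)
      = ∑ j, (#{I : Finset κ | i ∈ I ∧ j ∉ I} : ℝ) * f i j := by
    intro i
    rw [Finset.sum_comm]
    refine Finset.sum_congr rfl fun j _ => ?_
    rw [← Finset.sum_filter, Finset.sum_const, nsmul_eq_mul]
  simp only [h2, Finset.mul_sum]
  refine Finset.sum_congr rfl fun i _ => Finset.sum_congr rfl fun j _ => ?_
  by_cases hij : i = j
  · subst hij
    simp
  · have h3 : (4 * #{I : Finset κ | i ∈ I ∧ j ∉ I} : ℝ) = 2 ^ Fintype.card κ := by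
      exact_mod_cast four_mul_card_filter_mem_notMem hij
    rw [if_neg hij]
    have : (2 ^ Fintype.card κ : ℝ) ≠ 0 := by positivity
    field_simp
    rw [← h3]
    ring

theorem block_quadForm_pow_le {E κ : Type*} [Fintype κ] [DecidableEq κ]
    (R : E → κ → ℝ) (I : Finset κ) (z : κ → E) (w : κ → ℝ) (q : ℕ) :
    (∑ i ∈ I, w i * (R (z i) ⬝ᵥ w)) ^ (2 * (q + 1)) ≤
      (∑ i, w i ^ 2) ^ (2 * (q + 1)) * (rowGram R I z ^ (q + 1)).trace := by
  set s := ∑ i, w i ^ 2 with hs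
  have hs0 : 0 ≤ s := Finset.sum_nonneg fun i _ => sq_nonneg _
  have hww : w ⬝ᵥ w = s := by simp only [dotProduct, hs, sq]
  have hG := rowGram_posSemidef R I z
  have hquad : w ⬝ᵥ (rowGram R I z *ᵥ w) = ∑ i ∈ I, (R (z i) ⬝ᵥ w) ^ 2 := by
    unfold rowGram
    rw [Matrix.sum_mulVec, dotProduct_sum]
    refine Finset.sum_congr rfl fun i _ => ?_
    rw [Matrix.vecMulVec_mulVec, op_smul_eq_smul, dotProduct_smul, smul_eq_mul,
      dotProduct_comm w, sq]
  have h1 : (∑ i ∈ I, w i * (R (z i) ⬝ᵥ w)) ^ 2 ≤ s * (w ⬝ᵥ (rowGram R I z *ᵥ w)) := by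
    refine (Finset.sum_mul_sq_le_sq_mul_sq I _ _).trans ?_
    rw [hquad]
    exact mul_le_mul_of_nonneg_right
      (Finset.sum_le_univ_sum_of_nonneg fun i : κ => sq_nonneg (w i))
      (Finset.sum_nonneg fun i _ => sq_nonneg _)
  have h2 := hG.dotProduct_mulVec_pow_le w q
  have h3 := (hG.pow (q + 1)).dotProduct_mulVec_le_trace w
  rw [hww] at h2 h3
  rw [pow_mul]
  calc _ ≤ (s * (w ⬝ᵥ (rowGram R I z *ᵥ w))) ^ (q + 1) := by gcongr
    _ ≤ s ^ (q + 1) * (s ^ q * ((rowGram R I z ^ (q + 1)).trace * s)) := by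
        rw [mul_pow]
        gcongr
        exact h2.trans (by gcongr)
    _ = _ := by ring

theorem offDiag_quadForm_pow_le {E κ : Type*} [Fintype κ] [DecidableEq κ]
    (k : E → E → ℝ) (z : κ → E) (w : κ → ℝ) (q : ℕ) :
    (∑ i, ∑ j, (if i = j then 0 else w i * w j * k (z i) (z j))) ^ (2 * (q + 1)) ≤
      4 ^ (2 * (q + 1)) * averageTrace k (q + 1) z * (∑ i, w i ^ 2) ^ (2 * (q + 1)) := by
  rw [offDiag_sum_eq_average, mul_pow, mul_assoc]
  refine mul_le_mul_of_nonneg_left ?_ (by positivity)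
  have hone : ∑ _I : Finset κ, (2 ^ Fintype.card κ : ℝ)⁻¹ = 1 := by
    rw [Finset.sum_const, Finset.card_univ, Fintype.card_finset, nsmul_eq_mul]
    push_cast
    exact mul_inv_cancel₀ (by positivity)
  refine (Real.pow_arith_mean_le_arith_mean_pow_of_even Finset.univ _ _
    (fun _ _ => by positivity) hone (even_two_mul _)).trans ?_
  rw [averageTrace, Finset.sum_mul]
  refine Finset.sum_le_sum fun I _ => ?_
  rw [mul_assoc, mul_comm (Matrix.trace _)]
  refine mul_le_mul_of_nonneg_left ?_ (by positivity)
  refine le_trans (le_of_eq ?_) (block_quadForm_pow_le (offRow k I z) I z w q)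
  congr 1
  refine Finset.sum_congr rfl fun i _ => ?_
  rw [dotProduct, Finset.mul_sum]
  refine Finset.sum_congr rfl fun j _ => ?_
  by_cases h : j ∈ I <;> simp [offRow, h]
  ring

/-- The absolute moment of order `a` of the standard Gaussian distribution. -/
noncomputable def gaussianAbsMoment (a : ℝ) : ℝ := ∫ x, |x| ^ a ∂gaussianReal 0 1

theorem gaussianAbsMoment_nonneg (a : ℝ) : 0 ≤ gaussianAbsMoment a :=
  integral_nonneg fun _ => by positivity

theorem integrable_abs_rpow_mul_exp_gaussianReal {a : ℝ} (ha : 0 ≤ a) (t : ℝ) :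
    Integrable (fun x => |x| ^ a * Real.exp (t * x)) (gaussianReal 0 1) := by
  refine integrable_rpow_abs_mul_exp_of_mem_interior_integrableExpSet (X := id) ?_ ha
  simp

theorem integrable_abs_rpow_gaussianReal {a : ℝ} (ha : 0 ≤ a) :
    Integrable (fun x => |x| ^ a) (gaussianReal 0 1) := by
  simpa using integrable_abs_rpow_mul_exp_gaussianReal ha 0

theorem integrable_abs_rpow_mul_cosh_gaussianReal {a : ℝ} (ha : 0 ≤ a) (t : ℝ) :
    Integrable (fun x => |x| ^ a * Real.cosh (t * x)) (gaussianReal 0 1) := by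
  refine (((integrable_abs_rpow_mul_exp_gaussianReal ha t).add
    (integrable_abs_rpow_mul_exp_gaussianReal ha (-t))).div_const 2).congr
    (ae_of_all _ fun x => ?_)
  simp only [Pi.add_apply, Real.cosh_eq, neg_mul]
  ring

theorem abs_add_rpow_le {a : ℝ} (ha : 0 ≤ a) (x y : ℝ) :
    |x + y| ^ a ≤ 2 ^ a * (|x| ^ a + |y| ^ a) := by
  have h1 : |x + y| ≤ 2 * max |x| |y| :=
    (abs_add_le x y).trans (by linarith [le_max_left |x| |y|, le_max_right |x| |y|])
  calc |x + y| ^ a ≤ (2 * max |x| |y|) ^ a := Real.rpow_le_rpow (abs_nonneg _) h1 ha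
    _ = 2 ^ a * (max |x| |y|) ^ a := Real.mul_rpow (by norm_num) (by positivity)
    _ ≤ _ := by
      refine mul_le_mul_of_nonneg_left ?_ (by positivity)
      have hx : 0 ≤ |x| ^ a := by positivity
      have hy : 0 ≤ |y| ^ a := by positivity
      rcases max_choice |x| |y| with h | h <;> rw [h] <;> linarith

theorem integrable_abs_add_rpow_gaussianReal {a : ℝ} (ha : 0 ≤ a) (t : ℝ) :
    Integrable (fun x => |x + t| ^ a) (gaussianReal 0 1) := by
  refine (((integrable_abs_rpow_gaussianReal ha).add (integrable_const (|t| ^ a))).const_mul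
    (2 ^ a)).mono' (by fun_prop) (ae_of_all _ fun x => ?_)
  rw [Real.norm_of_nonneg (by positivity)]
  exact abs_add_rpow_le ha x t

theorem integral_abs_add_rpow_gaussianReal_le {a : ℝ} (ha : 0 ≤ a) (t : ℝ) :
    ∫ x, |x + t| ^ a ∂gaussianReal 0 1 ≤ 2 ^ a * (gaussianAbsMoment a + |t| ^ a) := by
  have hi := (integrable_abs_rpow_gaussianReal ha).add (integrable_const (μ := gaussianReal 0 1)
    (|t| ^ a))
  refine (integral_mono (integrable_abs_add_rpow_gaussianReal ha t) (hi.const_mul (2 ^ a))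
    fun x => abs_add_rpow_le ha x t).trans (le_of_eq ?_)
  rw [integral_const_mul, integral_add' (integrable_abs_rpow_gaussianReal ha)
    (integrable_const _)]
  simp [gaussianAbsMoment]

theorem integral_abs_add_rpow_gaussianReal {a : ℝ} (ha : 0 ≤ a) (t : ℝ) :
    ∫ x, |x + t| ^ a ∂gaussianReal 0 1 =
      Real.exp (-t ^ 2 / 2) * ∫ x, |x| ^ a * Real.cosh (t * x) ∂gaussianReal 0 1 := by
  have h1 : ∫ x, |x + t| ^ a ∂gaussianReal 0 1 =
      Real.exp (-t ^ 2 / 2) * ∫ x, |x| ^ a * Real.exp (t * x) ∂gaussianReal 0 1 := by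
    have : ∫ x, |x| ^ a ∂gaussianReal t 1 = ∫ x, |x + t| ^ a ∂gaussianReal 0 1 := by
      have h := gaussianReal_map_add_const (μ := 0) (v := 1) t
      rw [zero_add] at h
      rw [← h, integral_map (by fun_prop)]
      exact (by fun_prop : Measurable fun x : ℝ => |x| ^ a).aestronglyMeasurable
    rw [← this, integral_gaussianReal_eq_integral_smul one_ne_zero,
      integral_gaussianReal_eq_integral_smul one_ne_zero, ← integral_const_mul]
    refine integral_congr_ae (ae_of_all _ fun x => ?_)
    simp only [gaussianPDFReal, smul_eq_mul, NNReal.coe_one, mul_one, sub_zero]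
    have : Real.exp (-(x - t) ^ 2 / 2) =
        Real.exp (-t ^ 2 / 2) * Real.exp (-x ^ 2 / 2) * Real.exp (t * x) := by
      rw [← Real.exp_add, ← Real.exp_add]
      ring_nf
    rw [this]
    ring
  have h2 : ∫ x, |x| ^ a * Real.exp (-t * x) ∂gaussianReal 0 1 =
      ∫ x, |x| ^ a * Real.exp (t * x) ∂gaussianReal 0 1 := by
    have h := gaussianReal_map_neg (μ := 0) (v := 1)
    rw [neg_zero] at h
    conv_lhs => rw [← h]
    rw [integral_map (by fun_prop) (by fun_prop)]
    simp
  rw [h1]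
  congr 1
  have h3 := integral_add (integrable_abs_rpow_mul_exp_gaussianReal ha t)
    (integrable_abs_rpow_mul_exp_gaussianReal ha (-t))
  rw [h2] at h3
  have h4 : ∫ x, |x| ^ a * Real.cosh (t * x) ∂gaussianReal 0 1 =
      2⁻¹ * ∫ x, (|x| ^ a * Real.exp (t * x) + |x| ^ a * Real.exp (-t * x))
        ∂gaussianReal 0 1 := by
    rw [← integral_const_mul]
    refine integral_congr_ae (ae_of_all _ fun x => ?_)
    simp only [Real.cosh_eq, neg_mul]
    ring
  rw [h4, h3]
  ring

theorem Real.cosh_le_one_add_sq_mul_cosh (x : ℝ) :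
    Real.cosh x ≤ 1 + x ^ 2 / 2 * Real.cosh x := by
  have h1 := mul_le_mul_of_nonneg_right (Real.cosh_le_exp_half_sq x)
    (Real.exp_pos (-(x ^ 2 / 2))).le
  rw [← Real.exp_add, add_neg_cancel, Real.exp_zero] at h1
  nlinarith [mul_le_mul_of_nonneg_left (Real.add_one_le_exp (-(x ^ 2 / 2))) (Real.cosh_pos x).le]

/-- The absolute moments of a shifted Gaussian depend quadratically on small shifts. -/
theorem abs_integral_abs_add_rpow_sub_le {a : ℝ} (ha : 0 ≤ a) (t : ℝ) :
    |∫ x, |x + t| ^ a ∂gaussianReal 0 1 - gaussianAbsMoment a| ≤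
      t ^ 2 * (gaussianAbsMoment a +
        2 ^ (a + 2) * (gaussianAbsMoment (a + 2) + |t| ^ (a + 2))) := by
  have hlow : Real.exp (-t ^ 2 / 2) * gaussianAbsMoment a ≤
      ∫ x, |x + t| ^ a ∂gaussianReal 0 1 := by
    rw [integral_abs_add_rpow_gaussianReal ha]
    refine mul_le_mul_of_nonneg_left (integral_mono (integrable_abs_rpow_gaussianReal ha)
      (integrable_abs_rpow_mul_cosh_gaussianReal ha t) fun x => ?_) (by positivity)
    exact le_mul_of_one_le_right (by positivity) (Real.one_le_cosh _)
  have hup : ∫ x, |x + t| ^ a ∂gaussianReal 0 1 ≤ gaussianAbsMoment a +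
      t ^ 2 / 2 * ∫ x, |x + t| ^ (a + 2) ∂gaussianReal 0 1 := by
    rw [integral_abs_add_rpow_gaussianReal ha,
      integral_abs_add_rpow_gaussianReal (by linarith : 0 ≤ a + 2)]
    have h1 : ∫ x, |x| ^ a * Real.cosh (t * x) ∂gaussianReal 0 1 ≤ gaussianAbsMoment a +
        t ^ 2 / 2 * ∫ x, |x| ^ (a + 2) * Real.cosh (t * x) ∂gaussianReal 0 1 := by
      rw [gaussianAbsMoment, ← integral_const_mul, ← integral_add
        (integrable_abs_rpow_gaussianReal ha)
        ((integrable_abs_rpow_mul_cosh_gaussianReal (by linarith) t).const_mul _)]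
      refine integral_mono (integrable_abs_rpow_mul_cosh_gaussianReal ha t)
        ((integrable_abs_rpow_gaussianReal ha).add
        ((integrable_abs_rpow_mul_cosh_gaussianReal (by linarith) t).const_mul _)) fun x => ?_
      have h2 : |x| ^ (a + 2) = |x| ^ a * x ^ 2 := by
        rw [Real.rpow_add_of_nonneg (abs_nonneg x) ha (by norm_num), Real.rpow_two, sq_abs]
      simp only [h2]
      calc |x| ^ a * Real.cosh (t * x)
          ≤ |x| ^ a * (1 + (t * x) ^ 2 / 2 * Real.cosh (t * x)) :=
            mul_le_mul_of_nonneg_left (Real.cosh_le_one_add_sq_mul_cosh _) (by positivity)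
        _ = _ := by ring
    have h3 : Real.exp (-t ^ 2 / 2) ≤ 1 := Real.exp_le_one_iff.2 (by nlinarith [sq_nonneg t])
    calc _ ≤ Real.exp (-t ^ 2 / 2) * (gaussianAbsMoment a +
        t ^ 2 / 2 * ∫ x, |x| ^ (a + 2) * Real.cosh (t * x) ∂gaussianReal 0 1) :=
          mul_le_mul_of_nonneg_left h1 (by positivity)
      _ ≤ _ := by
        have := mul_le_mul_of_nonneg_right h3 (gaussianAbsMoment_nonneg a)
        linarith
  have h4 := integral_abs_add_rpow_gaussianReal_le (by linarith : 0 ≤ a + 2) t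
  have h5 := gaussianAbsMoment_nonneg a
  have h6 : 1 - t ^ 2 / 2 ≤ Real.exp (-t ^ 2 / 2) := by
    have := Real.add_one_le_exp (-t ^ 2 / 2)
    linarith
  have h7 : 0 ≤ 2 ^ (a + 2) * (gaussianAbsMoment (a + 2) + |t| ^ (a + 2)) := by
    have := gaussianAbsMoment_nonneg (a + 2)
    positivity
  have h8 := mul_le_mul_of_nonneg_right h6 h5
  have h9 := mul_le_mul_of_nonneg_left h4 (by positivity : 0 ≤ t ^ 2 / 2)
  have h10 := mul_nonneg (sq_nonneg t) h7
  have h11 := mul_nonneg (sq_nonneg t) h5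
  rw [abs_le]
  constructor <;> nlinarith

theorem map_inner_stdGaussian {E : Type*} [NormedAddCommGroup E] [InnerProductSpace ℝ E]
    [FiniteDimensional ℝ E] [MeasurableSpace E] [BorelSpace E] {v : E} (hv : ‖v‖ = 1) :
    (stdGaussian E).map (fun x => inner ℝ v x) = gaussianReal 0 1 := by
  have h := IsGaussian.map_eq_gaussianReal (μ := stdGaussian E) (innerSL ℝ v)
  rw [integral_strongDual_stdGaussian, variance_dual_stdGaussian, innerSL_apply_norm, hv] at h
  simpa using! h

theorem map_inner_inner_stdGaussian {E : Type*} [NormedAddCommGroup E] [InnerProductSpace ℝ E]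
    [FiniteDimensional ℝ E] [MeasurableSpace E] [BorelSpace E] {v e : E} (hv : ‖v‖ = 1)
    (he : ‖e‖ = 1) (hve : inner ℝ v e = 0) :
    (stdGaussian E).map (fun x => (inner ℝ v x, inner ℝ e x)) =
      (gaussianReal 0 1).prod (gaussianReal 0 1) := by
  have hlaw : HasGaussianLaw (fun x => (inner ℝ v x, inner ℝ e x)) (stdGaussian E) :=
    IsGaussian.hasGaussianLaw_id.map ((innerSL ℝ v).prod (innerSL ℝ e))
  have hcov : cov[fun x => inner ℝ v x, fun x => inner ℝ e x; stdGaussian E] = 0 := by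
    have := covarianceBilin_apply_eq_cov (μ := stdGaussian E) IsGaussian.memLp_two_id v e
    rw [← this, covarianceBilin_stdGaussian]
    exact hve
  have hind := hlaw.indepFun_of_covariance_eq_zero hcov
  rw [indepFun_iff_map_prod_eq_prod_map_map (by fun_prop) (by fun_prop)] at hind
  rw [hind, map_inner_stdGaussian hv, map_inner_stdGaussian he]

/-- A bound for the deviation of the inner integral in the covariance of `|g|^a` and
`|ρ g + σ z|^a`, up to a factor `ρ ^ 2`. -/
noncomputable def gaussianCovKernel (a g : ℝ) : ℝ :=
  2 * g ^ 2 * (gaussianAbsMoment a + 2 ^ (a + 2) * (gaussianAbsMoment (a + 2) + |g| ^ (a + 2))) +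
    (a + 1) * gaussianAbsMoment a

theorem one_sub_le_rpow_of_sq_add_sq_eq_one {a ρ σ : ℝ} (ha : 0 ≤ a) (hσ : 0 ≤ σ)
    (h : ρ ^ 2 + σ ^ 2 = 1) : 1 - (a + 1) * ρ ^ 2 ≤ σ ^ a := by
  have hσ1 : σ ≤ 1 := by nlinarith [sq_nonneg ρ]
  have h1 := one_add_mul_self_le_rpow_one_add (s := -ρ ^ 2) (by nlinarith [sq_nonneg σ])
    (p := a + 1) (by linarith)
  rw [show 1 + -ρ ^ 2 = σ ^ 2 by linarith] at h1
  calc 1 - (a + 1) * ρ ^ 2 ≤ (σ ^ 2) ^ (a + 1) := by linarith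
    _ ≤ (σ ^ 2) ^ a := Real.rpow_le_rpow_of_exponent_ge_of_imp (by positivity)
        (by nlinarith) (by linarith) (fun _ _ => by linarith)
    _ ≤ σ ^ a := Real.rpow_le_rpow (by positivity) (by nlinarith) ha

theorem abs_integral_abs_mul_add_mul_rpow_sub_le {a ρ σ : ℝ} (ha : 0 ≤ a) (hσ : 0 < σ)
    (h : ρ ^ 2 + σ ^ 2 = 1) (hρ : ρ ^ 2 ≤ 1 / 2) (g : ℝ) :
    |∫ z, |ρ * g + σ * z| ^ a ∂gaussianReal 0 1 - gaussianAbsMoment a| ≤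
      ρ ^ 2 * gaussianCovKernel a g := by
  set t := ρ * g / σ with ht
  have hσ1 : σ ≤ 1 := by nlinarith [sq_nonneg ρ]
  have e1 : ∫ z, |ρ * g + σ * z| ^ a ∂gaussianReal 0 1 =
      σ ^ a * ∫ z, |z + t| ^ a ∂gaussianReal 0 1 := by
    rw [← integral_const_mul]
    refine integral_congr_ae (ae_of_all _ fun z => ?_)
    have : ρ * g + σ * z = σ * (z + t) := by
      rw [ht]
      field_simp
      ring
    simp only [this, abs_mul, abs_of_pos hσ]
    exact Real.mul_rpow hσ.le (abs_nonneg _)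
  have h1 := abs_integral_abs_add_rpow_sub_le ha t
  have hσa1 : σ ^ a ≤ 1 := Real.rpow_le_one hσ.le hσ1 ha
  have hσa0 : 0 ≤ σ ^ a := by positivity
  have hσa := one_sub_le_rpow_of_sq_add_sq_eq_one ha hσ.le h
  have ht2 : t ^ 2 ≤ 2 * ρ ^ 2 * g ^ 2 := by
    rw [ht, div_pow, div_le_iff₀ (by positivity)]
    nlinarith [mul_nonneg (sq_nonneg ρ) (sq_nonneg g)]
  have htg : |t| ≤ |g| := by
    refine sq_le_sq.1 (ht2.trans ?_)
    nlinarith [sq_nonneg g]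
  have hc := gaussianAbsMoment_nonneg a
  have hc2 := gaussianAbsMoment_nonneg (a + 2)
  have h2 : t ^ 2 * (gaussianAbsMoment a +
      2 ^ (a + 2) * (gaussianAbsMoment (a + 2) + |t| ^ (a + 2))) ≤ 2 * ρ ^ 2 * g ^ 2 *
      (gaussianAbsMoment a + 2 ^ (a + 2) * (gaussianAbsMoment (a + 2) + |g| ^ (a + 2))) := by
    gcongr
  rw [e1]
  calc _ = |σ ^ a * (∫ z, |z + t| ^ a ∂gaussianReal 0 1 - gaussianAbsMoment a) -
        (1 - σ ^ a) * gaussianAbsMoment a| := by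
        congr 1
        ring
    _ ≤ σ ^ a * |∫ z, |z + t| ^ a ∂gaussianReal 0 1 - gaussianAbsMoment a| +
        (1 - σ ^ a) * gaussianAbsMoment a := by
        refine (abs_sub _ _).trans (le_of_eq ?_)
        rw [abs_mul, abs_of_nonneg hσa0, abs_of_nonneg (mul_nonneg (by linarith) hc)]
    _ ≤ 1 * |∫ z, |z + t| ^ a ∂gaussianReal 0 1 - gaussianAbsMoment a| +
        ((a + 1) * ρ ^ 2) * gaussianAbsMoment a := by
        gcongr
        linarith
    _ ≤ _ := by
        rw [gaussianCovKernel]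
        linarith

theorem integrable_abs_rpow_mul_gaussianCovKernel {a : ℝ} (ha : 0 ≤ a) :
    Integrable (fun g => |g| ^ a * gaussianCovKernel a g) (gaussianReal 0 1) := by
  have h1 := integrable_abs_rpow_gaussianReal ha
  have h2 := integrable_abs_rpow_gaussianReal (by linarith : 0 ≤ a + 2)
  have h3 := integrable_abs_rpow_gaussianReal (by linarith : 0 ≤ a + 2 + (a + 2))
  refine (((h2.mul_const (2 * (gaussianAbsMoment a + 2 ^ (a + 2) * gaussianAbsMoment (a + 2)))).add
    (h3.mul_const (2 * 2 ^ (a + 2)))).add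
    (h1.mul_const ((a + 1) * gaussianAbsMoment a))).congr (ae_of_all _ fun g => ?_)
  have e1 : |g| ^ (a + 2) = |g| ^ a * g ^ 2 := by
    rw [Real.rpow_add_of_nonneg (abs_nonneg g) ha (by norm_num), Real.rpow_two, sq_abs]
  have e2 : |g| ^ (a + 2 + (a + 2)) = |g| ^ (a + 2) * |g| ^ (a + 2) :=
    Real.rpow_add_of_nonneg (abs_nonneg g) (by linarith) (by linarith)
  simp only [Pi.add_apply, gaussianCovKernel]
  rw [e2, e1]
  ring

/-- The constant in the covariance bound for `a`-th absolute powers of two standard Gaussian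
variables. -/
noncomputable def gaussianCovBound (a : ℝ) : ℝ :=
  ∫ g, |g| ^ a * gaussianCovKernel a g ∂gaussianReal 0 1 +
    2 * (gaussianAbsMoment (2 * a) + gaussianAbsMoment a ^ 2)

section stdGaussian

variable {E : Type*} [NormedAddCommGroup E] [InnerProductSpace ℝ E]
    [FiniteDimensional ℝ E] [MeasurableSpace E] [BorelSpace E]

theorem integrable_abs_inner_rpow_stdGaussian {a : ℝ} (ha : 0 ≤ a) {v : E} (hv : ‖v‖ = 1) :
    Integrable (fun x => |inner ℝ v x| ^ a) (stdGaussian E) := by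
  have h := integrable_abs_rpow_gaussianReal ha
  rw [← map_inner_stdGaussian hv] at h
  exact h.comp_measurable (by fun_prop)

theorem integral_abs_inner_rpow_stdGaussian (a : ℝ) {v : E} (hv : ‖v‖ = 1) :
    ∫ x, |inner ℝ v x| ^ a ∂stdGaussian E = gaussianAbsMoment a := by
  rw [gaussianAbsMoment, ← map_inner_stdGaussian hv, integral_map (by fun_prop)]
  exact (by fun_prop : Measurable fun x : ℝ => |x| ^ a).aestronglyMeasurable

theorem abs_rpow_mul_abs_rpow_le (a x y : ℝ) :
    |x| ^ a * |y| ^ a ≤ (|x| ^ (2 * a) + |y| ^ (2 * a)) / 2 := by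
  have h : ∀ x : ℝ, |x| ^ (2 * a) = (|x| ^ a) ^ 2 := fun x => by
    rw [mul_comm, Real.rpow_mul (abs_nonneg x), Real.rpow_two]
  rw [h, h]
  nlinarith [sq_nonneg (|x| ^ a - |y| ^ a)]

theorem integrable_abs_inner_rpow_mul_stdGaussian {a : ℝ} (ha : 0 ≤ a) {v w : E} (hv : ‖v‖ = 1)
    (hw : ‖w‖ = 1) :
    Integrable (fun x => |inner ℝ v x| ^ a * |inner ℝ w x| ^ a) (stdGaussian E) := by
  refine (((integrable_abs_inner_rpow_stdGaussian (by linarith : 0 ≤ 2 * a) hv).add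
    (integrable_abs_inner_rpow_stdGaussian (by linarith : 0 ≤ 2 * a) hw)).div_const 2).mono'
    (by fun_prop) (ae_of_all _ fun x => ?_)
  rw [Real.norm_of_nonneg (by positivity)]
  exact abs_rpow_mul_abs_rpow_le _ _ _

theorem integral_abs_inner_rpow_mul_stdGaussian_le {a : ℝ} (ha : 0 ≤ a) {v w : E}
    (hv : ‖v‖ = 1) (hw : ‖w‖ = 1) :
    ∫ x, |inner ℝ v x| ^ a * |inner ℝ w x| ^ a ∂stdGaussian E ≤ gaussianAbsMoment (2 * a) := by
  have h1 := integrable_abs_inner_rpow_stdGaussian (by linarith : 0 ≤ 2 * a) hv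
  have h2 := integrable_abs_inner_rpow_stdGaussian (by linarith : 0 ≤ 2 * a) hw
  refine (integral_mono (integrable_abs_inner_rpow_mul_stdGaussian ha hv hw)
    ((h1.add h2).div_const 2) fun x => abs_rpow_mul_abs_rpow_le _ _ _).trans (le_of_eq ?_)
  rw [integral_div, integral_add' h1 h2, integral_abs_inner_rpow_stdGaussian _ hv,
    integral_abs_inner_rpow_stdGaussian _ hw]
  ring

theorem gaussianCovKernel_nonneg {a : ℝ} (ha : 0 ≤ a) (g : ℝ) : 0 ≤ gaussianCovKernel a g := by
  have h1 := gaussianAbsMoment_nonneg a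
  have h2 := gaussianAbsMoment_nonneg (a + 2)
  unfold gaussianCovKernel
  positivity

theorem gaussianCovBound_nonneg {a : ℝ} (ha : 0 ≤ a) : 0 ≤ gaussianCovBound a := by
  have h1 := gaussianAbsMoment_nonneg (2 * a)
  have h2 : 0 ≤ ∫ g, |g| ^ a * gaussianCovKernel a g ∂gaussianReal 0 1 :=
    integral_nonneg fun g => mul_nonneg (by positivity) (gaussianCovKernel_nonneg ha g)
  unfold gaussianCovBound
  positivity

/-- The absolute powers of two standard Gaussian variables with correlation `ρ` have covariance
of order `ρ ^ 2`. -/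
theorem abs_cov_abs_inner_rpow_le {a : ℝ} (ha : 0 ≤ a) {v w : E} (hv : ‖v‖ = 1) (hw : ‖w‖ = 1) :
    |∫ x, |inner ℝ v x| ^ a * |inner ℝ w x| ^ a ∂stdGaussian E - gaussianAbsMoment a ^ 2| ≤
      gaussianCovBound a * inner ℝ v w ^ 2 := by
  set ρ : ℝ := inner ℝ v w with hρ
  have hK : 0 ≤ ∫ g, |g| ^ a * gaussianCovKernel a g ∂gaussianReal 0 1 :=
    integral_nonneg fun g => mul_nonneg (by positivity) (gaussianCovKernel_nonneg ha g)
  have hc := gaussianAbsMoment_nonneg a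
  have hc2 := gaussianAbsMoment_nonneg (2 * a)
  rcases le_total (1 / 2) (ρ ^ 2) with h | h
  · have h1 := integral_abs_inner_rpow_mul_stdGaussian_le ha hv hw
    have h2 : 0 ≤ ∫ x, |inner ℝ v x| ^ a * |inner ℝ w x| ^ a ∂stdGaussian E :=
      integral_nonneg fun x => by positivity
    have h3 : gaussianAbsMoment (2 * a) + gaussianAbsMoment a ^ 2 ≤ gaussianCovBound a * ρ ^ 2 := by
      have h4 := mul_le_mul_of_nonneg_left h (gaussianCovBound_nonneg ha)
      unfold gaussianCovBound at h4 ⊢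
      linarith
    rw [abs_le]
    constructor <;> nlinarith [sq_nonneg (gaussianAbsMoment a)]
  · set σ := Real.sqrt (1 - ρ ^ 2) with hσ
    have hσpos : 0 < σ := Real.sqrt_pos.2 (by linarith)
    have hσ2 : ρ ^ 2 + σ ^ 2 = 1 := by rw [hσ, Real.sq_sqrt (by linarith)]; ring
    set e : E := σ⁻¹ • (w - ρ • v) with he
    have hwe : w = ρ • v + σ • e := by
      rw [he, smul_inv_smul₀ hσpos.ne']
      abel
    have hvv : inner ℝ v v = 1 := by rw [real_inner_self_eq_norm_sq, hv]; norm_num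
    have hww : inner ℝ w w = 1 := by rw [real_inner_self_eq_norm_sq, hw]; norm_num
    have hve : inner ℝ v e = 0 := by
      rw [he, inner_smul_right, inner_sub_right, inner_smul_right, hvv, ← hρ]
      ring
    have hne : ‖e‖ = 1 := by
      have h1 : σ ^ 2 * inner ℝ e e = 1 - ρ ^ 2 := by
        have := hww
        rw [hwe] at this
        simp only [inner_add_left, inner_add_right, inner_smul_left, inner_smul_right, hvv, hve,
          real_inner_comm v e, conj_trivial] at this
        linarith
      rw [real_inner_self_eq_norm_sq, show 1 - ρ ^ 2 = σ ^ 2 by linarith] at h1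
      have h2 : ‖e‖ ^ 2 = 1 := by
        have : σ ^ 2 ≠ 0 := by positivity
        field_simp at h1
        exact h1
      nlinarith [norm_nonneg e]
    have hmap := map_inner_inner_stdGaussian hv hne hve
    have e1 : ∀ x, inner ℝ w x = ρ * inner ℝ v x + σ * inner ℝ e x := fun x => by
      conv_lhs => rw [hwe]
      rw [inner_add_left, real_inner_smul_left, real_inner_smul_left]
    have hmeas : Measurable fun p : ℝ × ℝ => |p.1| ^ a * |ρ * p.1 + σ * p.2| ^ a := by fun_prop
    have e2 : ∫ x, |inner ℝ v x| ^ a * |inner ℝ w x| ^ a ∂stdGaussian E =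
        ∫ p : ℝ × ℝ, |p.1| ^ a * |ρ * p.1 + σ * p.2| ^ a
          ∂(gaussianReal 0 1).prod (gaussianReal 0 1) := by
      rw [← hmap, integral_map (by fun_prop) hmeas.aestronglyMeasurable]
      simp only [e1]
    have hint : Integrable (fun p : ℝ × ℝ => |p.1| ^ a * |ρ * p.1 + σ * p.2| ^ a)
        ((gaussianReal 0 1).prod (gaussianReal 0 1)) := by
      rw [← hmap, integrable_map_measure hmeas.aestronglyMeasurable (by fun_prop)]
      refine (integrable_abs_inner_rpow_mul_stdGaussian ha hv hw).congr (ae_of_all _ fun x => ?_)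
      simp only [Function.comp, e1]
    have hint2 := hint.integral_prod_left
    simp only [integral_const_mul] at hint2
    have hi := integrable_abs_rpow_gaussianReal ha
    rw [e2, integral_prod _ hint]
    simp only [integral_const_mul]
    have e3 : ∫ g, |g| ^ a * ∫ z, |ρ * g + σ * z| ^ a ∂gaussianReal 0 1 ∂gaussianReal 0 1 -
        gaussianAbsMoment a ^ 2 = ∫ g, |g| ^ a * (∫ z, |ρ * g + σ * z| ^ a ∂gaussianReal 0 1 -
          gaussianAbsMoment a) ∂gaussianReal 0 1 := by
      simp only [mul_sub]
      rw [integral_sub hint2 (hi.mul_const _), integral_mul_const, sq]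
      rfl
    rw [e3]
    refine abs_integral_le_integral_abs.trans ?_
    have e4 : ∫ g, |(|g| ^ a * (∫ z, |ρ * g + σ * z| ^ a ∂gaussianReal 0 1 -
          gaussianAbsMoment a))| ∂gaussianReal 0 1 ≤
        ∫ g, ρ ^ 2 * (|g| ^ a * gaussianCovKernel a g) ∂gaussianReal 0 1 := by
      refine integral_mono_of_nonneg (ae_of_all _ fun g => abs_nonneg _)
        ((integrable_abs_rpow_mul_gaussianCovKernel ha).const_mul _) (ae_of_all _ fun g => ?_)
      simp only
      rw [abs_mul, abs_of_nonneg (by positivity : (0 : ℝ) ≤ |g| ^ a), mul_left_comm]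
      exact mul_le_mul_of_nonneg_left
        (abs_integral_abs_mul_add_mul_rpow_sub_le ha hσpos hσ2 h g) (by positivity)
    refine e4.trans ?_
    rw [integral_const_mul, gaussianCovBound]
    nlinarith [sq_nonneg ρ, mul_nonneg (sq_nonneg ρ)
      (add_nonneg hc2 (sq_nonneg (gaussianAbsMoment a)))]

end stdGaussian

section stdGaussian

variable {E : Type*} [NormedAddCommGroup E] [InnerProductSpace ℝ E]
    [FiniteDimensional ℝ E] [MeasurableSpace E] [BorelSpace E]

variable (E) in
/-- The moments of the norm of a standard Gaussian vector. -/
noncomputable def gaussianNormMoment (a : ℝ) : ℝ := ∫ x, ‖x‖ ^ a ∂stdGaussian E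

theorem integrable_norm_rpow_stdGaussian {a : ℝ} (ha : 0 ≤ a) :
    Integrable (fun x => ‖x‖ ^ a) (stdGaussian E) := by
  have h := (IsGaussian.memLp_id (stdGaussian E) (ENNReal.ofReal a)
    ENNReal.ofReal_ne_top).integrable_norm_rpow'
  simpa [ENNReal.toReal_ofReal ha] using h

theorem gaussianNormMoment_sq_le {a : ℝ} (ha : 0 ≤ a) :
    gaussianNormMoment E a ^ 2 ≤ gaussianNormMoment E (2 * a) := by
  have h1 := integrable_norm_rpow_stdGaussian (E := E) ha
  have h2 := integrable_norm_rpow_stdGaussian (E := E) (by linarith : 0 ≤ 2 * a)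
  set r := gaussianNormMoment E a with hr
  have h3 : 0 ≤ ∫ x, (‖x‖ ^ a - r) ^ 2 ∂stdGaussian E := integral_nonneg fun x => sq_nonneg _
  have h4 : ∀ x : E, (‖x‖ ^ a - r) ^ 2 = ‖x‖ ^ (2 * a) - 2 * r * ‖x‖ ^ a + r ^ 2 := fun x => by
    rw [mul_comm 2 a, Real.rpow_mul (norm_nonneg x), Real.rpow_two]
    ring
  simp only [h4] at h3
  have h5 : Integrable (fun x : E => ‖x‖ ^ (2 * a) - 2 * r * ‖x‖ ^ a) (stdGaussian E) :=
    h2.sub (h1.const_mul _)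
  rw [integral_add h5 (integrable_const _), integral_sub h2 (h1.const_mul _),
    integral_const_mul] at h3
  simp only [integral_const, probReal_univ, one_smul] at h3
  change 0 ≤ gaussianNormMoment E (2 * a) - 2 * r * r + r ^ 2 at h3
  linarith

theorem integral_abs_inner_rpow_stdGaussian' {a : ℝ} (ha : 0 < a) (y : E) :
    ∫ x, |inner ℝ y x| ^ a ∂stdGaussian E = ‖y‖ ^ a * gaussianAbsMoment a := by
  rcases eq_or_ne y 0 with rfl | hy
  · simp [Real.zero_rpow ha.ne']
  have hn : ‖(‖y‖⁻¹ • y)‖ = 1 := norm_smul_inv_norm hy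
  rw [← integral_abs_inner_rpow_stdGaussian a hn, ← integral_const_mul]
  refine integral_congr_ae (ae_of_all _ fun x => ?_)
  simp only
  rw [← Real.mul_rpow (norm_nonneg _) (abs_nonneg _), inner_smul_left, abs_mul]
  congr 1
  have : ‖y‖ ≠ 0 := norm_ne_zero_iff.2 hy
  simp [this]

theorem integral_norm_rpow_mul_abs_inner_rpow_congr (a : ℝ) {v w : E} (h : ‖v‖ = ‖w‖) :
    ∫ x, ‖x‖ ^ a * |inner ℝ v x| ^ a ∂stdGaussian E =
      ∫ x, ‖x‖ ^ a * |inner ℝ w x| ^ a ∂stdGaussian E := by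
  let f := (ℝ ∙ (v - w))ᗮ.reflection
  have hf : f v = w := Submodule.reflection_sub h
  have hmap := stdGaussian_map f
  conv_rhs => rw [← hmap]
  rw [integral_map (by fun_prop) (by fun_prop : Measurable fun x : E =>
    ‖x‖ ^ a * |inner ℝ w x| ^ a).aestronglyMeasurable]
  refine integral_congr_ae (ae_of_all _ fun x => ?_)
  simp only
  rw [← hf, LinearIsometryEquiv.inner_map_map, LinearIsometryEquiv.norm_map]

theorem integrable_norm_rpow_mul_abs_inner_rpow {a : ℝ} (ha : 0 ≤ a) (v : E) :
    Integrable (fun x => ‖x‖ ^ a * |inner ℝ v x| ^ a) (stdGaussian E) := by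
  refine ((integrable_norm_rpow_stdGaussian (E := E) (by linarith : 0 ≤ a + a)).mul_const
    (‖v‖ ^ a)).mono' (by fun_prop) (ae_of_all _ fun x => ?_)
  rw [Real.norm_of_nonneg (by positivity), Real.rpow_add_of_nonneg (norm_nonneg _) ha ha,
    mul_assoc]
  refine mul_le_mul_of_nonneg_left ?_ (by positivity)
  rw [← Real.mul_rpow (norm_nonneg _) (norm_nonneg _), mul_comm]
  exact Real.rpow_le_rpow (abs_nonneg _) (abs_real_inner_le_norm v x) ha

/-- By rotation invariance the mixed moment of the norm and of a coordinate is determined by the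
moments of the norm and of a coordinate. -/
theorem gaussianNormMoment_mul_integral {a : ℝ} (ha : 0 < a) {v : E} (hv : ‖v‖ = 1) :
    gaussianNormMoment E a * ∫ x, ‖x‖ ^ a * |inner ℝ v x| ^ a ∂stdGaussian E =
      gaussianAbsMoment a * gaussianNormMoment E (2 * a) := by
  have h2a : ∀ x : E, ‖x‖ ^ (2 * a) = ‖x‖ ^ a * ‖x‖ ^ a := fun x => by
    rw [two_mul, Real.rpow_add_of_nonneg (norm_nonneg _) ha.le ha.le]
  have hint : Integrable (fun p : E × E => ‖p.1‖ ^ a * |inner ℝ p.2 p.1| ^ a)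
      ((stdGaussian E).prod (stdGaussian E)) := by
    refine ((integrable_norm_rpow_stdGaussian (E := E) (by linarith : 0 ≤ 2 * a)).mul_prod
      (integrable_norm_rpow_stdGaussian (E := E) ha.le)).mono' ?_ (ae_of_all _ fun p => ?_)
    · exact (by fun_prop : Measurable fun p : E × E =>
        ‖p.1‖ ^ a * |inner ℝ p.2 p.1| ^ a).aestronglyMeasurable
    · rw [Real.norm_of_nonneg (by positivity), h2a, mul_assoc]
      refine mul_le_mul_of_nonneg_left ?_ (by positivity)
      rw [← Real.mul_rpow (norm_nonneg _) (norm_nonneg _), mul_comm]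
      exact Real.rpow_le_rpow (abs_nonneg _) (abs_real_inner_le_norm _ _) ha.le
  have hswap := integral_integral_swap (f := fun x y : E => ‖x‖ ^ a * |inner ℝ y x| ^ a) hint
  have e1 : ∀ x : E, ∫ y, ‖x‖ ^ a * |inner ℝ y x| ^ a ∂stdGaussian E =
      gaussianAbsMoment a * ‖x‖ ^ (2 * a) := fun x => by
    simp only [real_inner_comm x, integral_const_mul]
    rw [integral_abs_inner_rpow_stdGaussian' ha, h2a]
    ring
  have e2 : ∀ y : E, ∫ x, ‖x‖ ^ a * |inner ℝ y x| ^ a ∂stdGaussian E =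
      ‖y‖ ^ a * ∫ x, ‖x‖ ^ a * |inner ℝ v x| ^ a ∂stdGaussian E := fun y => by
    rcases eq_or_ne y 0 with rfl | hy
    · simp [Real.zero_rpow ha.ne']
    have hy' : ‖y‖ ≠ 0 := norm_ne_zero_iff.2 hy
    have hn : ‖v‖ = ‖(‖y‖⁻¹ • y)‖ := hv.trans (norm_smul_inv_norm hy).symm
    rw [integral_norm_rpow_mul_abs_inner_rpow_congr a hn, ← integral_const_mul]
    refine integral_congr_ae (ae_of_all _ fun x => ?_)
    simp only
    rw [mul_left_comm, ← Real.mul_rpow (norm_nonneg y) (abs_nonneg _), inner_smul_left, abs_mul]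
    congr 2
    simp [hy']
  rw [integral_congr_ae (ae_of_all _ e1), integral_congr_ae (ae_of_all _ e2),
    integral_const_mul, integral_mul_const] at hswap
  exact hswap.symm

theorem integral_sum_abs_inner_rpow_sub_sq_le {ι : Type*} {a : ℝ} (ha : 0 < a)
    (hR : 0 < gaussianNormMoment E a) (S : Finset ι) {v : ι → E} (hv : ∀ j ∈ S, ‖v j‖ = 1)
    (w : ι → ℝ) :
    ∫ x, (∑ j ∈ S, w j * (|inner ℝ (v j) x| ^ a -
        gaussianAbsMoment a / gaussianNormMoment E a * ‖x‖ ^ a)) ^ 2 ∂stdGaussian E ≤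
      gaussianCovBound a * ∑ i ∈ S, ∑ j ∈ S, |w i| * |w j| * inner ℝ (v i) (v j) ^ 2 := by
  set c := gaussianAbsMoment a with hc
  set κ := c / gaussianNormMoment E a with hκ
  set N := gaussianNormMoment E (2 * a) with hN
  have hκN : c ^ 2 ≤ κ ^ 2 * N := by
    rw [hκ, div_pow, div_mul_eq_mul_div, le_div_iff₀ (by positivity)]
    exact mul_le_mul_of_nonneg_left (gaussianNormMoment_sq_le ha.le) (sq_nonneg _)
  have hβ : ∀ j ∈ S, ∫ x, ‖x‖ ^ a * |inner ℝ (v j) x| ^ a ∂stdGaussian E = κ * N := fun j hj => by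
    have := gaussianNormMoment_mul_integral ha (hv j hj)
    rw [hκ, div_mul_eq_mul_div, eq_div_iff hR.ne', mul_comm, this]
  have hI1 : ∀ i ∈ S, ∀ j ∈ S,
      Integrable (fun x => |inner ℝ (v i) x| ^ a * |inner ℝ (v j) x| ^ a) (stdGaussian E) :=
    fun i hi j hj => integrable_abs_inner_rpow_mul_stdGaussian ha.le (hv i hi) (hv j hj)
  have hI2 : ∀ i, Integrable (fun x => ‖x‖ ^ a * |inner ℝ (v i) x| ^ a) (stdGaussian E) :=
    fun i => integrable_norm_rpow_mul_abs_inner_rpow ha.le (v i)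
  have hI3 := integrable_norm_rpow_stdGaussian (E := E) (by linarith : 0 ≤ 2 * a)
  have hsq : ∀ x : E, (∑ j ∈ S, w j * (|inner ℝ (v j) x| ^ a - κ * ‖x‖ ^ a)) ^ 2 =
      ∑ i ∈ S, ∑ j ∈ S, w i * w j * (|inner ℝ (v i) x| ^ a * |inner ℝ (v j) x| ^ a -
        κ * (‖x‖ ^ a * |inner ℝ (v i) x| ^ a) - κ * (‖x‖ ^ a * |inner ℝ (v j) x| ^ a) +
        κ ^ 2 * ‖x‖ ^ (2 * a)) := fun x => by
    rw [sq, Finset.sum_mul_sum]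
    refine Finset.sum_congr rfl fun i _ => Finset.sum_congr rfl fun j _ => ?_
    rw [mul_comm 2 a, Real.rpow_mul (norm_nonneg x), Real.rpow_two]
    ring
  have hI4 : ∀ i ∈ S, ∀ j ∈ S, Integrable (fun x =>
      w i * w j * (|inner ℝ (v i) x| ^ a * |inner ℝ (v j) x| ^ a -
        κ * (‖x‖ ^ a * |inner ℝ (v i) x| ^ a) - κ * (‖x‖ ^ a * |inner ℝ (v j) x| ^ a) +
        κ ^ 2 * ‖x‖ ^ (2 * a))) (stdGaussian E) := fun i hi j hj =>
    ((((hI1 i hi j hj).sub ((hI2 i).const_mul _)).sub ((hI2 j).const_mul _)).add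
      (hI3.const_mul _)).const_mul _
  simp only [hsq]
  rw [integral_finsetSum _ fun i hi => integrable_finsetSum _ fun j hj => hI4 i hi j hj,
    Finset.mul_sum]
  simp only [Finset.mul_sum]
  have hterm : ∀ i ∈ S, ∀ j ∈ S, ∫ x, w i * w j * (|inner ℝ (v i) x| ^ a *
      |inner ℝ (v j) x| ^ a -
        κ * (‖x‖ ^ a * |inner ℝ (v i) x| ^ a) - κ * (‖x‖ ^ a * |inner ℝ (v j) x| ^ a) +
        κ ^ 2 * ‖x‖ ^ (2 * a)) ∂stdGaussian E =
      w i * w j * (∫ x, |inner ℝ (v i) x| ^ a * |inner ℝ (v j) x| ^ a ∂stdGaussian E - c ^ 2) -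
        w i * w j * (κ ^ 2 * N - c ^ 2) := fun i hi j hj => by
    have hI5 : Integrable (fun x => |inner ℝ (v i) x| ^ a * |inner ℝ (v j) x| ^ a -
        κ * (‖x‖ ^ a * |inner ℝ (v i) x| ^ a)) (stdGaussian E) :=
      (hI1 i hi j hj).sub ((hI2 i).const_mul _)
    have hI6 : Integrable (fun x => |inner ℝ (v i) x| ^ a * |inner ℝ (v j) x| ^ a -
        κ * (‖x‖ ^ a * |inner ℝ (v i) x| ^ a) - κ * (‖x‖ ^ a * |inner ℝ (v j) x| ^ a))
        (stdGaussian E) := hI5.sub ((hI2 j).const_mul _)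
    rw [integral_const_mul, integral_add hI6 (hI3.const_mul _),
      integral_sub hI5 ((hI2 j).const_mul _),
      integral_sub (hI1 i hi j hj) ((hI2 i).const_mul _), integral_const_mul, integral_const_mul,
      integral_const_mul, hβ i hi, hβ j hj]
    change _ * (_ - _ - _ + κ ^ 2 * N) = _
    ring
  calc _ = ∑ i ∈ S, ∑ j ∈ S, (w i * w j * (∫ x, |inner ℝ (v i) x| ^ a * |inner ℝ (v j) x| ^ a
        ∂stdGaussian E - c ^ 2) - w i * w j * (κ ^ 2 * N - c ^ 2)) := by
        refine Finset.sum_congr rfl fun i hi => ?_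
        rw [integral_finsetSum _ fun j hj => hI4 i hi j hj]
        exact Finset.sum_congr rfl fun j hj => hterm i hi j hj
    _ = ∑ i ∈ S, ∑ j ∈ S, w i * w j * (∫ x, |inner ℝ (v i) x| ^ a * |inner ℝ (v j) x| ^ a
        ∂stdGaussian E - c ^ 2) - (∑ i ∈ S, w i) ^ 2 * (κ ^ 2 * N - c ^ 2) := by
        rw [sq (∑ i ∈ S, w i), Finset.sum_mul_sum, Finset.sum_mul, ← Finset.sum_sub_distrib]
        refine Finset.sum_congr rfl fun i _ => ?_
        rw [Finset.sum_mul, ← Finset.sum_sub_distrib]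
    _ ≤ ∑ i ∈ S, ∑ j ∈ S, w i * w j * (∫ x, |inner ℝ (v i) x| ^ a * |inner ℝ (v j) x| ^ a
        ∂stdGaussian E - c ^ 2) := by
        have := mul_nonneg (sq_nonneg (∑ i ∈ S, w i)) (sub_nonneg.2 hκN)
        linarith
    _ ≤ _ := by
        refine Finset.sum_le_sum fun i hi => Finset.sum_le_sum fun j hj => ?_
        refine (le_abs_self _).trans ?_
        rw [abs_mul, abs_mul, mul_left_comm]
        exact mul_le_mul_of_nonneg_left (abs_cov_abs_inner_rpow_le ha.le (hv i hi) (hv j hj))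
          (by positivity)

end stdGaussian

theorem sum_abs_mul_abs_mul_le {ι : Type*} [DecidableEq ι] (S : Finset ι) (w : ι → ℝ)
    {r : ι → ι → ℝ} (hr1 : ∀ i ∈ S, r i i ≤ 1) :
    ∑ i ∈ S, ∑ j ∈ S, |w i| * |w j| * r i j ≤
      (2 + ∑ i ∈ S, ∑ j ∈ S, if i = j then 0 else r i j ^ 2) * ∑ i ∈ S, w i ^ 2 := by
  set A := ∑ i ∈ S, w i ^ 2 with hA
  set s := ∑ i ∈ S, ∑ j ∈ S, if i = j then 0 else r i j ^ 2 with hs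
  have hA0 : 0 ≤ A := Finset.sum_nonneg fun i _ => sq_nonneg _
  have hs0 : 0 ≤ s := Finset.sum_nonneg fun i _ => Finset.sum_nonneg fun j _ => by
    split_ifs <;> positivity
  set O := ∑ i ∈ S, ∑ j ∈ S, |w i| * |w j| * (if i = j then 0 else r i j) with hO
  have hO2 : O ^ 2 ≤ A ^ 2 * s := by
    have h := Finset.sum_mul_sq_le_sq_mul_sq (S ×ˢ S) (fun p => |w p.1| * |w p.2|)
      (fun p => if p.1 = p.2 then 0 else r p.1 p.2)
    rw [Finset.sum_product, Finset.sum_product, Finset.sum_product] at h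
    refine h.trans (le_of_eq ?_)
    congr 1
    · simp only [mul_pow, sq_abs]
      rw [sq A, hA, Finset.sum_mul_sum]
    · refine Finset.sum_congr rfl fun i _ => Finset.sum_congr rfl fun j _ => ?_
      split_ifs <;> simp
  have hO1 : O ≤ A * (1 + s) := by
    refine le_of_sq_le_sq (hO2.trans ?_) (by positivity)
    rw [mul_pow]
    refine mul_le_mul_of_nonneg_left ?_ (sq_nonneg _)
    nlinarith
  have hsplit : ∑ i ∈ S, ∑ j ∈ S, |w i| * |w j| * r i j = ∑ i ∈ S, w i ^ 2 * r i i + O := by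
    rw [hO, ← Finset.sum_add_distrib]
    refine Finset.sum_congr rfl fun i hi => ?_
    have : w i ^ 2 * r i i = ∑ j ∈ S, if i = j then |w i| * |w j| * r i j else 0 := by
      rw [Finset.sum_ite_eq, if_pos hi, ← sq, sq_abs]
    rw [this, ← Finset.sum_add_distrib]
    refine Finset.sum_congr rfl fun j _ => ?_
    split_ifs <;> simp
  have hdiag : ∑ i ∈ S, w i ^ 2 * r i i ≤ A :=
    Finset.sum_le_sum fun i hi => mul_le_of_le_one_right (sq_nonneg _) (hr1 i hi)
  rw [hsplit]
  linarith

theorem norm_pos_of_le_sq {E : Type*} [NormedAddCommGroup E] {T : ℝ} (hT : 0 < T) {x : E}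
    (hx : T ≤ ‖x‖ ^ 2) : 0 < ‖x‖ := by
  by_contra h
  have : ‖x‖ = 0 := le_antisymm (not_lt.1 h) (norm_nonneg _)
  rw [this] at hx
  norm_num at hx
  linarith

theorem measurableSet_le_norm_sq_and {E : Type*} [NormedAddCommGroup E] [MeasurableSpace E]
    [BorelSpace E] (T : ℝ) :
    MeasurableSet {p : E × E | T ≤ ‖p.1‖ ^ 2 ∧ T ≤ ‖p.2‖ ^ 2} :=
  have h : MeasurableSet {x : E | T ≤ ‖x‖ ^ 2} :=
    measurableSet_le measurable_const (measurable_norm.pow_const 2)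
  h.prod h

section Kernel

variable {E : Type*} [NormedAddCommGroup E] [InnerProductSpace ℝ E]

/-- The `a`-th absolute power of the cosine of the angle between `x` and `y`, centered by `κ` and
truncated to vectors whose squared norm is at least `T`. -/
noncomputable def centeredKernel (a κ T : ℝ) (x y : E) : ℝ :=
  if T ≤ ‖x‖ ^ 2 ∧ T ≤ ‖y‖ ^ 2 then |inner ℝ y x| ^ a / (‖x‖ * ‖y‖) ^ a - κ else 0

/-- The fourth power of the cosine of the angle between `x` and `y`, truncated to vectors whose
squared norm is at least `T`. -/
noncomputable def truncatedCosFour (T : ℝ) (x y : E) : ℝ :=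
  if T ≤ ‖x‖ ^ 2 ∧ T ≤ ‖y‖ ^ 2 then (inner ℝ x y / (‖x‖ * ‖y‖)) ^ 4 else 0

/-- The sum of the truncated fourth powers of the cosines of all pairs in a family. -/
noncomputable def cosFourSum {κ : Type*} [Fintype κ] [DecidableEq κ] (T : ℝ) (y : κ → E) : ℝ :=
  ∑ i, ∑ j, if i = j then 0 else truncatedCosFour T (y i) (y j)

theorem truncatedCosFour_nonneg (T : ℝ) (x y : E) : 0 ≤ truncatedCosFour T x y := by
  unfold truncatedCosFour
  split_ifs <;> positivity

theorem cosFourSum_nonneg {κ : Type*} [Fintype κ] [DecidableEq κ] (T : ℝ) (y : κ → E) :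
    0 ≤ cosFourSum T y :=
  Finset.sum_nonneg fun i _ => Finset.sum_nonneg fun j _ => by
    split_ifs
    exacts [le_rfl, truncatedCosFour_nonneg _ _ _]

theorem centeredKernel_eq {a T : ℝ} (hT : 0 < T) (κ : ℝ) {x y : E}
    (hx : T ≤ ‖x‖ ^ 2) (hy : T ≤ ‖y‖ ^ 2) :
    centeredKernel a κ T x y =
      (‖x‖ ^ a)⁻¹ * (|inner ℝ (‖y‖⁻¹ • y) x| ^ a - κ * ‖x‖ ^ a) := by
  have hx0 := norm_pos_of_le_sq hT hx
  have hy0 := norm_pos_of_le_sq hT hy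
  have hxa : ‖x‖ ^ a ≠ 0 := (Real.rpow_pos_of_pos hx0 a).ne'
  rw [centeredKernel, if_pos ⟨hx, hy⟩, inner_smul_left, abs_mul, conj_trivial,
    abs_of_pos (inv_pos.2 hy0), Real.mul_rpow (inv_pos.2 hy0).le (abs_nonneg _),
    Real.inv_rpow hy0.le, Real.mul_rpow hx0.le hy0.le]
  field_simp

theorem inv_rpow_sq_le {a T r : ℝ} (ha : 0 ≤ a) (hT : 0 < T) (hr : 0 < r) (h : T ≤ r ^ 2) :
    (r ^ a)⁻¹ ^ 2 ≤ T ^ (-a) := by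
  rw [inv_pow, Real.rpow_neg hT.le, ← Real.rpow_two (r ^ a), ← Real.rpow_mul hr.le, mul_comm a 2,
    Real.rpow_mul hr.le, Real.rpow_two]
  exact inv_anti₀ (Real.rpow_pos_of_pos hT a) (Real.rpow_le_rpow hT.le h ha)

theorem centeredKernel_eq_zero {a κ T : ℝ} {x y : E} (h : ¬ (T ≤ ‖x‖ ^ 2 ∧ T ≤ ‖y‖ ^ 2)) :
    centeredKernel a κ T x y = 0 := if_neg h

theorem abs_centeredKernel_le {a : ℝ} (ha : 0 ≤ a) (κ T : ℝ) (x y : E) :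
    |centeredKernel a κ T x y| ≤ 1 + |κ| := by
  unfold centeredKernel
  split_ifs
  · have h : |inner ℝ y x| ^ a / (‖x‖ * ‖y‖) ^ a ≤ 1 := by
      refine div_le_one_of_le₀ (Real.rpow_le_rpow (abs_nonneg _) ?_ ha) (by positivity)
      rw [mul_comm]
      exact abs_real_inner_le_norm y x
    refine (abs_sub _ _).trans ?_
    rw [abs_of_nonneg (by positivity)]
    linarith
  · rw [abs_zero]
    positivity

theorem abs_truncatedCosFour_le (T : ℝ) (x y : E) : |truncatedCosFour T x y| ≤ 1 := by
  rw [abs_of_nonneg (truncatedCosFour_nonneg _ _ _)]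
  unfold truncatedCosFour
  split_ifs
  · have := abs_real_inner_div_norm_mul_norm_le_one x y
    exact (even_two_mul 2).pow_abs (inner ℝ x y / (‖x‖ * ‖y‖)) ▸ pow_le_one₀ (abs_nonneg _) this
  · exact zero_le_one

theorem truncatedCosFour_eq {T : ℝ} {x y : E} (hx : T ≤ ‖x‖ ^ 2) (hy : T ≤ ‖y‖ ^ 2) :
    truncatedCosFour T x y = (inner ℝ (‖x‖⁻¹ • x) (‖y‖⁻¹ • y) ^ 2) ^ 2 := by
  rw [truncatedCosFour, if_pos ⟨hx, hy⟩, real_inner_smul_left, real_inner_smul_right, ← pow_mul]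
  congr 1
  rw [div_eq_mul_inv, mul_inv]
  ring

theorem centeredKernel_pow_le {a κ T : ℝ} (ha : 0 ≤ a) (hκ : 0 ≤ κ) (hT : 0 < T) {x y : E}
    (hy : T ≤ ‖y‖ ^ 2) (q : ℕ) :
    centeredKernel a κ T x y ^ (2 * q) ≤
      (T ^ (-a)) ^ q * |inner ℝ (‖y‖⁻¹ • y) x| ^ (2 * q * a) + κ ^ (2 * q) := by
  by_cases hx : T ≤ ‖x‖ ^ 2
  · have hx0 := norm_pos_of_le_sq hT hx
    rw [centeredKernel_eq hT κ hx hy]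
    set b := |inner ℝ (‖y‖⁻¹ • y) x| with hb
    have hb0 : 0 ≤ b := abs_nonneg _
    set u := (‖x‖ ^ a)⁻¹ * b ^ a with hu
    have hu0 : 0 ≤ u := by positivity
    have hxa : ‖x‖ ^ a ≠ 0 := (Real.rpow_pos_of_pos hx0 a).ne'
    have e1 : (‖x‖ ^ a)⁻¹ * (b ^ a - κ * ‖x‖ ^ a) = u - κ := by
      rw [hu]
      field_simp
    have h1 : |u - κ| ≤ max u κ := abs_sub_le_of_nonneg_of_le hu0 (le_max_left _ _) hκ
      (le_max_right _ _)
    have h2 : u ^ (2 * q) ≤ (T ^ (-a)) ^ q * b ^ (2 * q * a) := by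
      have e2 : b ^ (2 * q * a) = (b ^ a) ^ (2 * q) := by
        rw [mul_comm, Real.rpow_mul hb0]
        exact_mod_cast Real.rpow_natCast (b ^ a) (2 * q)
      rw [e2, hu, mul_pow]
      refine mul_le_mul_of_nonneg_right ?_ (by positivity)
      rw [pow_mul]
      exact pow_le_pow_left₀ (by positivity) (inv_rpow_sq_le ha hT hx0 hx) q
    rw [e1]
    calc (u - κ) ^ (2 * q) = |u - κ| ^ (2 * q) := ((even_two_mul q).pow_abs _).symm
      _ ≤ (max u κ) ^ (2 * q) := pow_le_pow_left₀ (abs_nonneg _) h1 _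
      _ ≤ u ^ (2 * q) + κ ^ (2 * q) := by
          have h3 : 0 ≤ u ^ (2 * q) := by positivity
          have h4 : 0 ≤ κ ^ (2 * q) := by positivity
          rcases max_choice u κ with h | h <;> rw [h] <;> linarith
      _ ≤ _ := by linarith
  · rw [centeredKernel_eq_zero fun h => hx h.1]
    have h1 : (0 : ℝ) ≤ (T ^ (-a)) ^ q * |inner ℝ (‖y‖⁻¹ • y) x| ^ (2 * q * a) := by positivity
    rcases Nat.eq_zero_or_pos q with rfl | hq
    · simp
    · rw [zero_pow (by omega)]
      positivity

variable [MeasurableSpace E] [BorelSpace E] [FiniteDimensional ℝ E]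

theorem boundedMeasurable_centeredKernel {a : ℝ} (ha : 0 ≤ a) (κ T : ℝ) :
    BoundedMeasurable fun p : E × E => centeredKernel a κ T p.1 p.2 := by
  refine ⟨?_, 1 + |κ|, fun p => abs_centeredKernel_le ha κ T p.1 p.2⟩
  exact Measurable.ite (measurableSet_le_norm_sq_and T) (by fun_prop) measurable_const

theorem boundedMeasurable_truncatedCosFour (T : ℝ) :
    BoundedMeasurable fun p : E × E => truncatedCosFour T p.1 p.2 := by
  refine ⟨?_, 1, fun p => abs_truncatedCosFour_le T p.1 p.2⟩
  exact Measurable.ite (measurableSet_le_norm_sq_and T) (by fun_prop) measurable_const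

theorem boundedMeasurable_cosFourSum {κ : Type*} [Fintype κ] [DecidableEq κ] (T : ℝ) :
    BoundedMeasurable fun y : κ → E => cosFourSum T y := by
  refine .sum _ fun i => .sum _ fun j => ?_
  by_cases h : i = j
  · simpa only [h, if_true] using .const 0
  · simp only [h, if_false]
    exact (boundedMeasurable_truncatedCosFour T).comp (h := fun y : κ → E => (y i, y j))
      (by fun_prop)

theorem integral_offRow_centeredKernel_pow_le {κ : Type*} [Fintype κ] [DecidableEq κ]
    {a c K T : ℝ} (ha : 0 ≤ a) (hc : 0 ≤ c) (hT : 0 < T) (hcK : c ^ 2 ≤ K * T ^ (-a))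
    (I : Finset κ) (y : κ → E) (q : ℕ) :
    ∫ x, (offRow (centeredKernel a c T) I y x ⬝ᵥ offRow (centeredKernel a c T) I y x) ^ q
      ∂stdGaussian E ≤
      (Fintype.card κ * T ^ (-a)) ^ q * (gaussianAbsMoment (2 * q * a) + K ^ q) := by
  set R := offRow (centeredKernel a c T) I y with hR
  have hTa : 0 < T ^ (-a) := Real.rpow_pos_of_pos hT _
  have hK : 0 ≤ K := by
    by_contra h
    nlinarith [mul_neg_of_neg_of_pos (not_le.1 h) hTa, sq_nonneg c]
  have hRm : ∀ j, BoundedMeasurable fun x => R x j := fun j =>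
    (boundedMeasurable_centeredKernel ha c T).offRow I measurable_const measurable_id j
  have hterm : ∀ j, ∫ x, R x j ^ (2 * q) ∂stdGaussian E ≤
      (T ^ (-a)) ^ q * (gaussianAbsMoment (2 * q * a) + K ^ q) := fun j => by
    have hrhs : 0 ≤ (T ^ (-a)) ^ q * (gaussianAbsMoment (2 * q * a) + K ^ q) := by
      have := gaussianAbsMoment_nonneg (2 * q * a)
      positivity
    by_cases hj : j ∉ I ∧ T ≤ ‖y j‖ ^ 2
    · have hn : ‖(‖y j‖⁻¹ • y j)‖ = 1 :=
        norm_smul_inv_norm (norm_pos_iff.1 (norm_pos_of_le_sq hT hj.2))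
      have hi := integrable_abs_inner_rpow_stdGaussian (by positivity : 0 ≤ 2 * q * a) hn
      calc ∫ x, R x j ^ (2 * q) ∂stdGaussian E ≤
          ∫ x, ((T ^ (-a)) ^ q * |inner ℝ (‖y j‖⁻¹ • y j) x| ^ (2 * q * a) + c ^ (2 * q))
            ∂stdGaussian E := by
            refine integral_mono (((hRm j).pow _).integrable _)
              ((hi.const_mul _).add (integrable_const _)) fun x => ?_
            simp only [hR, offRow, hj.1, if_false]
            exact centeredKernel_pow_le ha hc hT hj.2 q
        _ = (T ^ (-a)) ^ q * gaussianAbsMoment (2 * q * a) + c ^ (2 * q) := by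
            rw [integral_add (hi.const_mul _) (integrable_const _), integral_const_mul,
              integral_abs_inner_rpow_stdGaussian _ hn]
            simp
        _ ≤ _ := by
            have := pow_le_pow_left₀ (sq_nonneg c) hcK q
            rw [← pow_mul, mul_pow] at this
            linarith
    · have hz : ∀ x, R x j = 0 := fun x => by
        by_cases hjI : j ∈ I
        · simp [hR, offRow, hjI]
        · simp only [hR, offRow, hjI, if_false]
          exact centeredKernel_eq_zero fun h => hj ⟨hjI, h.2⟩
      simp only [hz]
      rcases Nat.eq_zero_or_pos q with rfl | hq
      · simp only [mul_zero, pow_zero, integral_const, probReal_univ, smul_eq_mul, mul_one, one_mul]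
        linarith [gaussianAbsMoment_nonneg ((2 : ℝ) * (0 : ℕ) * a)]
      · rw [zero_pow (by omega), integral_zero]
        exact hrhs
  rcases q with _ | q
  · simp only [pow_zero, integral_const, probReal_univ, smul_eq_mul, mul_one, one_mul]
    linarith [gaussianAbsMoment_nonneg ((2 : ℝ) * (0 : ℕ) * a)]
  have hpow : ∀ x, (R x ⬝ᵥ R x) ^ (q + 1) ≤
      (Fintype.card κ : ℝ) ^ q * ∑ j, R x j ^ (2 * (q + 1)) := fun x => by
    rcases isEmpty_or_nonempty κ with h | h
    · simp [dotProduct]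
    have hcard : (0 : ℝ) < (Fintype.card κ : ℝ) ^ q := by positivity
    have := pow_sum_div_card_le_sum_pow (s := Finset.univ) (f := fun j => R x j ^ 2)
      (fun j _ => sq_nonneg _) q
    rw [Finset.card_univ, div_le_iff₀' hcard] at this
    simpa only [dotProduct, ← sq, ← pow_mul] using this
  have hint : ∀ j, Integrable (fun x => R x j ^ (2 * (q + 1))) (stdGaussian E) := fun j =>
    ((hRm j).pow _).integrable _
  calc _ ≤ ∫ x, (Fintype.card κ : ℝ) ^ q * ∑ j, R x j ^ (2 * (q + 1)) ∂stdGaussian E :=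
        integral_mono (((BoundedMeasurable.dotProduct hRm hRm).pow _).integrable _)
          ((integrable_finsetSum _ fun j _ => hint j).const_mul _) hpow
    _ = (Fintype.card κ : ℝ) ^ q * ∑ j, ∫ x, R x j ^ (2 * (q + 1)) ∂stdGaussian E := by
        rw [integral_const_mul, integral_finsetSum _ fun j _ => hint j]
    _ ≤ (Fintype.card κ : ℝ) ^ q * ∑ _j : κ, (T ^ (-a)) ^ (q + 1) *
        (gaussianAbsMoment (2 * (q + 1 : ℕ) * a) + K ^ (q + 1)) :=
        mul_le_mul_of_nonneg_left (Finset.sum_le_sum fun j _ => hterm j) (by positivity)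
    _ = _ := by
        rw [Finset.sum_const, Finset.card_univ, nsmul_eq_mul, mul_pow, pow_succ (_ : ℝ) q]
        ring

end Kernel

section KernelMoments

variable {E : Type*} [NormedAddCommGroup E] [InnerProductSpace ℝ E]
  {κ : Type*} [Fintype κ] [DecidableEq κ]

theorem sum_mul_offRow_centeredKernel_sq_le {a c T : ℝ} (ha : 0 ≤ a) (hT : 0 < T)
    (I : Finset κ) (y : κ → E) (w : κ → ℝ) (x : E) :
    (∑ j, w j * offRow (centeredKernel a c T) I y x j) ^ 2 ≤
      T ^ (-a) * (∑ j with j ∉ I ∧ T ≤ ‖y j‖ ^ 2,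
        w j * (|inner ℝ (‖y j‖⁻¹ • y j) x| ^ a - c * ‖x‖ ^ a)) ^ 2 := by
  have hTa : 0 < T ^ (-a) := Real.rpow_pos_of_pos hT _
  by_cases hx : T ≤ ‖x‖ ^ 2
  · have hx0 := norm_pos_of_le_sq hT hx
    have h : ∑ j, w j * offRow (centeredKernel a c T) I y x j = (‖x‖ ^ a)⁻¹ *
        ∑ j with j ∉ I ∧ T ≤ ‖y j‖ ^ 2,
          w j * (|inner ℝ (‖y j‖⁻¹ • y j) x| ^ a - c * ‖x‖ ^ a) := by
      rw [Finset.mul_sum, Finset.sum_filter]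
      refine Finset.sum_congr rfl fun j _ => ?_
      split_ifs with hj
      · rw [offRow, if_neg hj.1, centeredKernel_eq hT c hx hj.2]
        ring
      · by_cases hjI : j ∈ I
        · simp [offRow, hjI]
        · rw [offRow, if_neg hjI, centeredKernel_eq_zero fun h => hj ⟨hjI, h.2⟩, mul_zero]
    rw [h, mul_pow]
    exact mul_le_mul_of_nonneg_right (inv_rpow_sq_le ha hT hx0 hx) (sq_nonneg _)
  · have h : ∑ j, w j * offRow (centeredKernel a c T) I y x j = 0 :=
      Finset.sum_eq_zero fun j _ => by
        rw [offRow, centeredKernel_eq_zero fun h => hx h.1, ite_self, mul_zero]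
    rw [h, zero_pow two_ne_zero]
    positivity

variable [MeasurableSpace E] [BorelSpace E] [FiniteDimensional ℝ E]

theorem sum_sum_integral_offRow_centeredKernel_le {a T : ℝ} (ha : 0 < a)
    (hR : 0 < gaussianNormMoment E a) (hT : 0 < T) (I : Finset κ) (y : κ → E) (w : κ → ℝ) :
    ∑ i, ∑ j, w i * w j *
      ∫ x, offRow (centeredKernel a (gaussianAbsMoment a / gaussianNormMoment E a) T) I y x i *
        offRow (centeredKernel a (gaussianAbsMoment a / gaussianNormMoment E a) T) I y x j
        ∂stdGaussian E ≤
      gaussianCovBound a * T ^ (-a) * (2 + cosFourSum T y) * ∑ i, w i ^ 2 := by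
  set c := gaussianAbsMoment a / gaussianNormMoment E a with hc
  set R := offRow (centeredKernel a c T) I y with hRdef
  have hTa : 0 < T ^ (-a) := Real.rpow_pos_of_pos hT _
  have hRm : ∀ j, BoundedMeasurable fun x => R x j := fun j =>
    (boundedMeasurable_centeredKernel ha.le c T).offRow I measurable_const measurable_id j
  have hv : ∀ j ∈ ({j | j ∉ I ∧ T ≤ ‖y j‖ ^ 2} : Finset κ), ‖(‖y j‖⁻¹ • y j)‖ = 1 :=
    fun j hj => norm_smul_inv_norm
      (norm_pos_iff.1 (norm_pos_of_le_sq hT (Finset.mem_filter.1 hj).2.2))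
  set S : Finset κ := {j | j ∉ I ∧ T ≤ ‖y j‖ ^ 2} with hS
  have hS2 : ∀ j ∈ S, T ≤ ‖y j‖ ^ 2 := fun j hj => (Finset.mem_filter.1 hj).2.2
  have hsq : ∀ x, ∑ i, ∑ j, w i * w j * (R x i * R x j) = (∑ j, w j * R x j) ^ 2 := fun x => by
    rw [sq, Finset.sum_mul_sum]
    refine Finset.sum_congr rfl fun i _ => Finset.sum_congr rfl fun j _ => ?_
    ring
  have hint : ∀ i j, Integrable (fun x => w i * w j * (R x i * R x j)) (stdGaussian E) :=
    fun i j => (((hRm i).mul (hRm j)).integrable _).const_mul _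
  have hlhs : ∑ i, ∑ j, w i * w j * ∫ x, R x i * R x j ∂stdGaussian E =
      ∫ x, (∑ j, w j * R x j) ^ 2 ∂stdGaussian E := by
    simp_rw [← hsq]
    rw [integral_finsetSum _ fun i _ => integrable_finsetSum _ fun j _ => hint i j]
    refine Finset.sum_congr rfl fun i _ => ?_
    rw [integral_finsetSum _ fun j _ => hint i j]
    refine Finset.sum_congr rfl fun j _ => ?_
    rw [integral_const_mul]
  have hG : Integrable (fun x => (∑ j ∈ S,
      w j * (|inner ℝ (‖y j‖⁻¹ • y j) x| ^ a - c * ‖x‖ ^ a)) ^ 2) (stdGaussian E) := by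
    have hn : Integrable (fun x : E => ‖x‖ ^ (2 * a)) (stdGaussian E) :=
      integrable_norm_rpow_stdGaussian (by linarith)
    refine ((hn.const_mul ((∑ j ∈ S, |w j| * (1 + |c|)) ^ 2))).mono' (by fun_prop)
      (ae_of_all _ fun x => ?_)
    have e : ‖x‖ ^ (2 * a) = (‖x‖ ^ a) ^ 2 := by
      rw [mul_comm, Real.rpow_mul (norm_nonneg _), Real.rpow_two]
    rw [Real.norm_of_nonneg (sq_nonneg _), e, ← mul_pow, ← sq_abs]
    refine pow_le_pow_left₀ (abs_nonneg _) ((Finset.abs_sum_le_sum_abs _ _).trans ?_) 2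
    rw [Finset.sum_mul]
    refine Finset.sum_le_sum fun j hj => ?_
    rw [abs_mul, mul_assoc]
    refine mul_le_mul_of_nonneg_left ((abs_sub _ _).trans ?_) (abs_nonneg _)
    have h1 : |inner ℝ (‖y j‖⁻¹ • y j) x| ^ a ≤ ‖x‖ ^ a := by
      refine Real.rpow_le_rpow (abs_nonneg _) ((abs_real_inner_le_norm _ _).trans ?_) ha.le
      rw [hv j hj, one_mul]
    rw [abs_of_nonneg (by positivity), abs_mul, abs_of_nonneg (by positivity : 0 ≤ ‖x‖ ^ a)]
    linarith
  rw [hlhs]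
  calc ∫ x, (∑ j, w j * R x j) ^ 2 ∂stdGaussian E ≤
      ∫ x, T ^ (-a) * (∑ j ∈ S,
        w j * (|inner ℝ (‖y j‖⁻¹ • y j) x| ^ a - c * ‖x‖ ^ a)) ^ 2 ∂stdGaussian E :=
        integral_mono (((BoundedMeasurable.sum _ fun j =>
          (BoundedMeasurable.const (w j)).mul (hRm j)).pow 2).integrable _) (hG.const_mul _)
          (sum_mul_offRow_centeredKernel_sq_le ha.le hT I y w)
    _ ≤ T ^ (-a) * (gaussianCovBound a * ∑ i ∈ S, ∑ j ∈ S, |w i| * |w j| *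
        inner ℝ (‖y i‖⁻¹ • y i) (‖y j‖⁻¹ • y j) ^ 2) := by
        rw [integral_const_mul]
        exact mul_le_mul_of_nonneg_left (integral_sum_abs_inner_rpow_sub_sq_le ha hR S hv w) hTa.le
    _ ≤ T ^ (-a) * (gaussianCovBound a * ((2 + cosFourSum T y) * ∑ i, w i ^ 2)) := by
        refine mul_le_mul_of_nonneg_left (mul_le_mul_of_nonneg_left ?_
          (gaussianCovBound_nonneg ha.le)) hTa.le
        refine (sum_abs_mul_abs_mul_le S w fun i hi => ?_).trans ?_
        · rw [real_inner_self_eq_norm_sq, hv i hi]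
          norm_num
        · have h0 := cosFourSum_nonneg T y
          have hterm : ∀ i j, 0 ≤ if i = j then 0 else truncatedCosFour T (y i) (y j) :=
            fun i j => by
              split_ifs
              exacts [le_rfl, truncatedCosFour_nonneg _ _ _]
          refine mul_le_mul (add_le_add le_rfl ?_) (Finset.sum_le_sum_of_subset_of_nonneg
            (Finset.subset_univ _) fun _ _ _ => sq_nonneg _)
            (Finset.sum_nonneg fun _ _ => sq_nonneg _) (by linarith)
          calc _ = ∑ i ∈ S, ∑ j ∈ S, if i = j then 0 else truncatedCosFour T (y i) (y j) := by
                refine Finset.sum_congr rfl fun i hi => Finset.sum_congr rfl fun j hj => ?_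
                rw [truncatedCosFour_eq (hS2 i hi) (hS2 j hj)]
            _ ≤ ∑ i ∈ S, ∑ j, if i = j then 0 else truncatedCosFour T (y i) (y j) :=
                Finset.sum_le_sum fun i _ => Finset.sum_le_sum_of_subset_of_nonneg
                  (Finset.subset_univ _) fun j _ _ => hterm i j
            _ ≤ _ := Finset.sum_le_sum_of_subset_of_nonneg (Finset.subset_univ _)
                fun i _ _ => Finset.sum_nonneg fun j _ => hterm i j
    _ = _ := by ring

end KernelMoments

/-- The constants in the moment bounds for the trace of the off-diagonal Gram matrices. -/
noncomputable def traceMomentConst (a K : ℝ) : ℕ → ℝ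
  | 0 => 1
  | q + 1 => 2 * 3 ^ q * (gaussianAbsMoment (2 * (q + 1 : ℕ) * a) + K ^ (q + 1) +
      gaussianCovBound a * traceMomentConst a K q)

theorem traceMomentConst_nonneg {a K : ℝ} (ha : 0 ≤ a) (hK : 0 ≤ K) (q : ℕ) :
    0 ≤ traceMomentConst a K q := by
  induction q with
  | zero => exact zero_le_one
  | succ q ih =>
    have h1 := gaussianAbsMoment_nonneg (2 * (q + 1 : ℕ) * a)
    have h2 := gaussianCovBound_nonneg ha
    simp only [traceMomentConst]
    positivity

section TraceMoments

variable {E : Type*} [NormedAddCommGroup E] [InnerProductSpace ℝ E]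

theorem truncatedCosFour_pow_le {T : ℝ} (hT : 0 < T) (x : E) {y : E} (hy : T ≤ ‖y‖ ^ 2) (p : ℕ) :
    truncatedCosFour T x y ^ (p + 1) ≤
      (T ^ 2)⁻¹ ^ (p + 1) * |inner ℝ (‖y‖⁻¹ • y) x| ^ (4 * (p + 1 : ℕ) : ℝ) := by
  by_cases hx : T ≤ ‖x‖ ^ 2
  · have hx0 := norm_pos_of_le_sq hT hx
    have e : |inner ℝ (‖y‖⁻¹ • y) x| ^ (4 * (p + 1 : ℕ) : ℝ) =
        (inner ℝ (‖y‖⁻¹ • y) x ^ 4) ^ (p + 1) := by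
      rw [← (by decide : Even 4).pow_abs, ← pow_mul, ← Real.rpow_natCast]
      push_cast
      rfl
    rw [e, ← mul_pow]
    refine pow_le_pow_left₀ (truncatedCosFour_nonneg _ _ _) ?_ _
    rw [truncatedCosFour_eq hx hy, ← pow_mul, real_inner_smul_left, mul_pow,
      real_inner_comm]
    refine mul_le_mul_of_nonneg_right ?_ ((by decide : Even 4).pow_nonneg _)
    rw [inv_pow, pow_mul]
    exact inv_anti₀ (by positivity) (pow_le_pow_left₀ hT.le hx 2)
  · rw [truncatedCosFour, if_neg fun h => hx h.1, zero_pow (by omega)]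
    positivity

variable [MeasurableSpace E] [BorelSpace E] [FiniteDimensional ℝ E] {κ : Type*} [Fintype κ]

theorem integral_truncatedCosFour_pow_le {T : ℝ} (hT : 0 < T) (y : E) (p : ℕ) :
    ∫ x, truncatedCosFour T x y ^ (p + 1) ∂stdGaussian E ≤
      (T ^ 2)⁻¹ ^ (p + 1) * gaussianAbsMoment (4 * (p + 1 : ℕ)) := by
  by_cases hy : T ≤ ‖y‖ ^ 2
  · have hn : ‖(‖y‖⁻¹ • y)‖ = 1 :=
      norm_smul_inv_norm (norm_pos_iff.1 (norm_pos_of_le_sq hT hy))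
    rw [← integral_abs_inner_rpow_stdGaussian _ hn, ← integral_const_mul]
    refine integral_mono ?_
      ((integrable_abs_inner_rpow_stdGaussian (by positivity) hn).const_mul _)
      fun x => truncatedCosFour_pow_le hT x hy p
    exact (((boundedMeasurable_truncatedCosFour T).comp (h := fun x : E => (x, y))
      (by fun_prop)).pow _).integrable _
  · have h : ∀ x, truncatedCosFour T x y = 0 := fun x => if_neg fun h => hy h.2
    have := gaussianAbsMoment_nonneg (4 * (p + 1 : ℕ))
    simp only [h, ne_eq, Nat.add_eq_zero_iff, one_ne_zero, and_false, not_false_eq_true, zero_pow,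
      integral_zero]
    positivity

theorem integral_pi_truncatedCosFour_pow_le {T : ℝ} (hT : 0 < T) {i j : κ} (hij : i ≠ j) (p : ℕ) :
    ∫ y : κ → E, truncatedCosFour T (y i) (y j) ^ (p + 1) ∂Measure.pi (fun _ => stdGaussian E) ≤
      (T ^ 2)⁻¹ ^ (p + 1) * gaussianAbsMoment (4 * (p + 1 : ℕ)) := by
  have hind : IndepFun (fun y : κ → E => y i) (fun y => y j)
      (Measure.pi fun _ => stdGaussian E) :=
    (iIndepFun_pi (μ := fun _ : κ => stdGaussian E) (X := fun _ x => x)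
      fun _ => aemeasurable_id).indepFun hij
  have hmap : (Measure.pi fun _ : κ => stdGaussian E).map (fun y => (y i, y j)) =
      (stdGaussian E).prod (stdGaussian E) := by
    rw [(indepFun_iff_map_prod_eq_prod_map_map (measurable_pi_apply i).aemeasurable
      (measurable_pi_apply j).aemeasurable).1 hind,
      (measurePreserving_eval (fun _ : κ => stdGaussian E) i).map_eq,
      (measurePreserving_eval (fun _ : κ => stdGaussian E) j).map_eq]
  have hb := (boundedMeasurable_truncatedCosFour (E := E) T).pow (p + 1)
  calc _ = ∫ q : E × E, truncatedCosFour T q.1 q.2 ^ (p + 1)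
        ∂((Measure.pi fun _ : κ => stdGaussian E).map fun y => (y i, y j)) := by
        rw [integral_map (by fun_prop) hb.1.aestronglyMeasurable]
    _ = ∫ y, ∫ x, truncatedCosFour T x y ^ (p + 1) ∂stdGaussian E ∂stdGaussian E := by
        rw [hmap, integral_prod_symm _ (hb.integrable _)]
    _ ≤ ∫ _y : E, (T ^ 2)⁻¹ ^ (p + 1) * gaussianAbsMoment (4 * (p + 1 : ℕ)) ∂stdGaussian E := by
        refine integral_mono (hb.integrable _).integral_prod_right (integrable_const _) fun y =>
          integral_truncatedCosFour_pow_le hT y p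
    _ = _ := by simp

variable [DecidableEq κ]

theorem integral_cosFourSum_pow_le {T : ℝ} (hT : 0 < T) (p : ℕ) :
    ∫ y : κ → E, cosFourSum T y ^ (p + 1) ∂Measure.pi (fun _ => stdGaussian E) ≤
      ((Fintype.card κ : ℝ) ^ 2 / T ^ 2) ^ (p + 1) * gaussianAbsMoment (4 * (p + 1 : ℕ)) := by
  have hm4 := gaussianAbsMoment_nonneg (4 * (p + 1 : ℕ))
  let t : κ × κ → (κ → E) → ℝ := fun q y =>
    if q.1 = q.2 then 0 else truncatedCosFour T (y q.1) (y q.2)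
  have ht : ∀ q, BoundedMeasurable (t q) := fun q => by
    by_cases h : q.1 = q.2
    · simpa only [t, h, if_true] using .const 0
    · simp only [t, h, if_false]
      exact (boundedMeasurable_truncatedCosFour T).comp (h := fun y : κ → E => (y q.1, y q.2))
        (by fun_prop)
  have ht0 : ∀ q y, 0 ≤ t q y := fun q y => by
    simp only [t]
    split_ifs
    exacts [le_rfl, truncatedCosFour_nonneg _ _ _]
  have hpow : ∀ y : κ → E, cosFourSum T y ^ (p + 1) ≤
      ((Fintype.card κ : ℝ) ^ 2) ^ p * ∑ q, t q y ^ (p + 1) := fun y => by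
    rcases isEmpty_or_nonempty κ with h | h
    · simp [cosFourSum]
    have hcard : (0 : ℝ) < ((Fintype.card κ : ℝ) ^ 2) ^ p := by positivity
    have := pow_sum_div_card_le_sum_pow (s := Finset.univ) (f := fun q => t q y)
      (fun q _ => ht0 q y) p
    rw [Finset.card_univ, Fintype.card_prod, Nat.cast_mul, ← sq, div_le_iff₀' hcard,
      Fintype.sum_prod_type] at this
    exact this
  have hint : ∀ q, Integrable (fun y => t q y ^ (p + 1)) (Measure.pi fun _ => stdGaussian E) :=
    fun q => ((ht q).pow _).integrable _
  calc _ ≤ ∫ y : κ → E, ((Fintype.card κ : ℝ) ^ 2) ^ p * ∑ q, t q y ^ (p + 1)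
        ∂Measure.pi (fun _ => stdGaussian E) :=
        integral_mono (((boundedMeasurable_cosFourSum T).pow _).integrable _)
          ((integrable_finsetSum _ fun q _ => hint q).const_mul _) hpow
    _ = ((Fintype.card κ : ℝ) ^ 2) ^ p * ∑ q, ∫ y, t q y ^ (p + 1)
        ∂Measure.pi (fun _ => stdGaussian E) := by
        rw [integral_const_mul, integral_finsetSum _ fun q _ => hint q]
    _ ≤ ((Fintype.card κ : ℝ) ^ 2) ^ p * ∑ _q : κ × κ, (T ^ 2)⁻¹ ^ (p + 1) *
        gaussianAbsMoment (4 * (p + 1 : ℕ)) := by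
        refine mul_le_mul_of_nonneg_left (Finset.sum_le_sum fun q _ => ?_) (by positivity)
        by_cases h : q.1 = q.2
        · simp only [t, h, if_true, ne_eq, Nat.add_eq_zero_iff, one_ne_zero, and_false,
            not_false_eq_true, zero_pow, integral_zero]
          positivity
        · simp only [t, h, if_false]
          exact integral_pi_truncatedCosFour_pow_le hT h p
    _ = _ := by
        rw [Finset.sum_const, Finset.card_univ, Fintype.card_prod, nsmul_eq_mul, Nat.cast_mul,
          div_eq_mul_inv, mul_pow _ (T ^ 2)⁻¹, pow_succ (_ ^ 2) p]
        ring

theorem integral_averageTrace_centeredKernel_le {a T K : ℝ} (ha : 0 < a)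
    (hR : 0 < gaussianNormMoment E a) (hT : 0 < T) (hK : 0 ≤ K)
    (hκ : (gaussianAbsMoment a / gaussianNormMoment E a) ^ 2 ≤ K * T ^ (-a)) (p : ℕ) :
    ∫ z : κ → E, averageTrace
      (centeredKernel a (gaussianAbsMoment a / gaussianNormMoment E a) T) (p + 1) z
      ∂Measure.pi (fun _ => stdGaussian E) ≤
    traceMomentConst a K (p + 1) * Fintype.card κ * (Fintype.card κ * T ^ (-a)) ^ (p + 1) *
      (2 ^ p * (2 ^ (p + 1) + ((Fintype.card κ : ℝ) ^ 2 / T ^ 2) ^ (p + 1) *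
        gaussianAbsMoment (4 * (p + 1 : ℕ)))) := by
  set c := gaussianAbsMoment a / gaussianNormMoment E a with hc
  have hc0 : 0 ≤ c := div_nonneg (gaussianAbsMoment_nonneg a) hR.le
  have hTa : 0 < T ^ (-a) := Real.rpow_pos_of_pos hT _
  have hcov := gaussianCovBound_nonneg ha.le
  have hk := boundedMeasurable_centeredKernel (E := E) ha.le c T
  have hD := traceMomentConst_nonneg ha.le hK
  set m : ℝ := (Fintype.card κ : ℝ) with hm
  have hH := (BoundedMeasurable.const (E := κ → E) 2).add (boundedMeasurable_cosFourSum (κ := κ) T)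
  refine (integral_averageTrace_le (stdGaussian E) hk (p + 1)
    (B := fun y => traceMomentConst a K (p + 1) * m * (m * T ^ (-a)) ^ (p + 1) *
      (2 + cosFourSum T y) ^ (p + 1)) (((hH.pow _).integrable _).const_mul _)
    fun I y => ?_).trans ?_
  · have hs := cosFourSum_nonneg T y
    set H := 2 + cosFourSum T y with hHdef
    have hH1 : 1 ≤ H := by linarith
    have := integral_trace_rowGram_pow_le (κ := κ) (stdGaussian E)
      (R := offRow (centeredKernel a c T) I y)
      (fun j => hk.offRow I measurable_const measurable_id j)
      (L := gaussianCovBound a * T ^ (-a) * H) (by positivity)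
      (sum_sum_integral_offRow_centeredKernel_le ha hR hT I y)
      (integral_offRow_centeredKernel_pow_le ha.le hc0 hT hκ I y)
      (a := fun q => traceMomentConst a K q * m * (m * T ^ (-a)) ^ q * H ^ q)
      (by simp [traceMomentConst, hm]) (fun q => ?_) (p + 1) I
    · exact this
    · rw [← hm]
      have hHq : 1 ≤ H ^ (q + 1) := one_le_pow₀ hH1
      have hg := gaussianAbsMoment_nonneg (2 * (q + 1 : ℕ) * a)
      have h0 : 0 ≤ m * (2 * 3 ^ q * ((m * T ^ (-a)) ^ (q + 1) *
          (gaussianAbsMoment (2 * (q + 1 : ℕ) * a) + K ^ (q + 1)))) := by positivity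
      have h1 := le_mul_of_one_le_right h0 hHq
      simp only [traceMomentConst]
      calc _ = m * (2 * 3 ^ q * ((m * T ^ (-a)) ^ (q + 1) *
          (gaussianAbsMoment (2 * (q + 1 : ℕ) * a) + K ^ (q + 1)))) +
          2 * 3 ^ q * (gaussianCovBound a * traceMomentConst a K q) * m *
            (m * T ^ (-a)) ^ (q + 1) * H ^ (q + 1) := by
            rw [pow_succ _ q, pow_succ H q]
            ring
        _ ≤ _ := by
            refine (add_le_add_left h1 _).trans (le_of_eq ?_)
            ring
  · rw [integral_const_mul]
    refine mul_le_mul_of_nonneg_left ?_ (mul_nonneg (mul_nonneg (hD _) (Nat.cast_nonneg _))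
      (by positivity))
    have hsi := ((boundedMeasurable_cosFourSum (E := E) (κ := κ) T).pow (p + 1)).integrable
      (Measure.pi fun _ => stdGaussian E)
    calc _ ≤ ∫ y : κ → E, 2 ^ p * (2 ^ (p + 1) + cosFourSum T y ^ (p + 1))
          ∂Measure.pi (fun _ => stdGaussian E) :=
          integral_mono ((hH.pow _).integrable _)
            (((integrable_const _).add hsi).const_mul _) fun y =>
              add_pow_le zero_le_two (cosFourSum_nonneg T y) (p + 1)
      _ ≤ _ := by
          rw [integral_const_mul, integral_add (integrable_const _) hsi]
          refine mul_le_mul_of_nonneg_left (add_le_add (by simp)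
            (integral_cosFourSum_pow_le hT p)) (by positivity)

end TraceMoments

theorem measurePreserving_uncurry_pi {κ ι E : Type*} [Fintype κ] [Fintype ι] [MeasurableSpace E]
    (γ : Measure E) [IsProbabilityMeasure γ] :
    MeasurePreserving (fun (x : κ → ι → E) (p : κ × ι) => x p.1 p.2)
      (Measure.pi fun _ => Measure.pi fun _ => γ) (Measure.pi fun _ => γ) := by
  have hm : Measurable fun (x : κ → ι → E) (p : κ × ι) => x p.1 p.2 := by fun_prop
  refine ⟨hm, (Measure.pi_eq fun s hs => ?_).symm⟩
  rw [Measure.map_apply hm (MeasurableSet.univ_pi hs)]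
  have : (fun (x : κ → ι → E) (p : κ × ι) => x p.1 p.2) ⁻¹' Set.univ.pi s =
      Set.univ.pi fun i => Set.univ.pi fun k => s (i, k) := by
    ext x
    simp [Set.mem_pi]
  rw [this, Measure.pi_pi, Fintype.prod_prod_type]
  simp only [Measure.pi_pi]

theorem map_pi_prod_eq_pi_stdGaussian {κ ι : Type*} [Fintype κ] [Fintype ι] :
    (Measure.pi fun _ : κ × ι => gaussianReal 0 1).map
      (fun x i => WithLp.toLp 2 fun k => x (i, k)) =
      Measure.pi fun _ : κ => stdGaussian (EuclideanSpace ℝ ι) := by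
  have h := measurePreserving_uncurry_pi (κ := κ) (ι := ι) (gaussianReal 0 1)
  rw [← h.map_eq, Measure.map_map (by fun_prop) h.measurable]
  have := Measure.pi_map_pi (μ := fun _ : κ => Measure.pi fun _ : ι => gaussianReal 0 1)
    (f := fun _ => WithLp.toLp 2) (hμ := fun _ => by
      rw [map_pi_eq_stdGaussian]
      infer_instance) (fun _ => by fun_prop)
  simp only [map_pi_eq_stdGaussian] at this
  exact this

theorem integral_exp_neg_sq_gaussianReal :
    ∫ x, Real.exp (-(x ^ 2 / 2)) ∂gaussianReal 0 1 = (√2)⁻¹ := by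
  rw [integral_gaussianReal_eq_integral_smul one_ne_zero]
  have h : ∀ x : ℝ, gaussianPDFReal 0 1 x • Real.exp (-(x ^ 2 / 2)) =
      (√(2 * Real.pi))⁻¹ * Real.exp (-1 * x ^ 2) := fun x => by
    rw [gaussianPDFReal, smul_eq_mul, mul_assoc, ← Real.exp_add]
    congr 2
    · simp
    · simp only [NNReal.coe_one, sub_zero]
      ring
  simp_rw [h]
  rw [integral_const_mul, integral_gaussian, div_one, Real.sqrt_mul zero_le_two, mul_inv, mul_assoc,
    inv_mul_cancel₀ (Real.sqrt_pos.2 Real.pi_pos).ne', mul_one]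

/-- The rate in the Chernoff bound for the event that a standard Gaussian vector is short. -/
noncomputable def chernoffRate : ℝ := Real.exp (1 / 4) * (√2)⁻¹

theorem chernoffRate_pos : 0 < chernoffRate := by
  unfold chernoffRate
  positivity

theorem chernoffRate_lt_one : chernoffRate < 1 := by
  rw [← pow_lt_one_iff_of_nonneg chernoffRate_pos.le (by norm_num : 4 ≠ 0)]
  have h2 : (√2 : ℝ) ^ 4 = 4 := by
    rw [show 4 = 2 * 2 from rfl, pow_mul, Real.sq_sqrt zero_le_two]
    norm_num
  rw [chernoffRate, mul_pow, inv_pow, h2, ← Real.exp_nat_mul]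
  norm_num
  linarith [Real.exp_one_lt_d9]

theorem measureReal_norm_sq_lt_le (n : ℕ) :
    (stdGaussian (EuclideanSpace ℝ (Fin n))).real {x | ‖x‖ ^ 2 < n / 2} ≤ chernoffRate ^ n := by
  have hint : Integrable (fun x : EuclideanSpace ℝ (Fin n) => Real.exp (-(‖x‖ ^ 2 / 2)))
      (stdGaussian (EuclideanSpace ℝ (Fin n))) := by
    refine BoundedMeasurable.integrable ⟨by fun_prop, 1, fun x => ?_⟩ _
    rw [abs_of_pos (Real.exp_pos _), Real.exp_le_one_iff]
    have := sq_nonneg ‖x‖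
    linarith
  have hval : ∫ x : EuclideanSpace ℝ (Fin n), Real.exp (-(‖x‖ ^ 2 / 2))
      ∂stdGaussian (EuclideanSpace ℝ (Fin n)) = (√2)⁻¹ ^ n := by
    rw [← map_pi_eq_stdGaussian, integral_map (by fun_prop)
      (Measurable.aestronglyMeasurable (by fun_prop))]
    have h : ∀ x : Fin n → ℝ, Real.exp (-(‖WithLp.toLp 2 x‖ ^ 2 / 2)) =
        ∏ k, Real.exp (-(x k ^ 2 / 2)) := fun x => by
      rw [← Real.exp_sum, EuclideanSpace.norm_sq_eq, Finset.sum_neg_distrib, Finset.sum_div]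
      simp
    simp_rw [h]
    rw [integral_fintype_prod_eq_prod (fun _ (t : ℝ) => Real.exp (-(t ^ 2 / 2)))]
    simp [integral_exp_neg_sq_gaussianReal]
  have hm := mul_meas_ge_le_integral_of_nonneg (ae_of_all _ fun x => (Real.exp_pos _).le) hint
    (Real.exp (-(n / 4)))
  rw [hval] at hm
  have hsub : (stdGaussian (EuclideanSpace ℝ (Fin n))).real {x | ‖x‖ ^ 2 < n / 2} ≤
      (stdGaussian (EuclideanSpace ℝ (Fin n))).real
        {x | Real.exp (-(n / 4)) ≤ Real.exp (-(‖x‖ ^ 2 / 2))} := by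
    refine measureReal_mono fun x hx => ?_
    simp only [Set.mem_ofPred_eq, Real.exp_le_exp] at hx ⊢
    linarith
  have he : Real.exp (1 / 4) ^ n * Real.exp (-(n / 4)) = 1 := by
    rw [← Real.exp_nat_mul, ← Real.exp_add]
    ring_nf
    exact Real.exp_zero
  calc _ ≤ _ := hsub
    _ = Real.exp (1 / 4) ^ n * (Real.exp (-(n / 4)) * (stdGaussian (EuclideanSpace ℝ (Fin n))).real
        {x | Real.exp (-(n / 4)) ≤ Real.exp (-(‖x‖ ^ 2 / 2))}) := by
        rw [← mul_assoc, he, one_mul]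
    _ ≤ Real.exp (1 / 4) ^ n * (√2)⁻¹ ^ n := mul_le_mul_of_nonneg_left hm (by positivity)
    _ = _ := (mul_pow _ _ _).symm

theorem half_mul_rpow_le_gaussianNormMoment {n : ℕ} {a : ℝ} (ha : 0 ≤ a)
    (hn : chernoffRate ^ n ≤ 1 / 2) :
    1 / 2 * ((n : ℝ) / 2) ^ (a / 2) ≤ gaussianNormMoment (EuclideanSpace ℝ (Fin n)) a := by
  set γ := stdGaussian (EuclideanSpace ℝ (Fin n)) with hγ
  have hT : (0 : ℝ) ≤ n / 2 := by positivity
  have hset : MeasurableSet {x : EuclideanSpace ℝ (Fin n) | ‖x‖ ^ 2 < n / 2} :=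
    measurableSet_lt (by fun_prop) measurable_const
  have hhalf : 1 / 2 ≤ γ.real {x | ‖x‖ ^ 2 < n / 2}ᶜ := by
    rw [probReal_compl_eq_one_sub hset]
    linarith [measureReal_norm_sq_lt_le n]
  have hm := mul_meas_ge_le_integral_of_nonneg
    (ae_of_all _ fun x : EuclideanSpace ℝ (Fin n) => Real.rpow_nonneg (norm_nonneg x) a)
    (integrable_norm_rpow_stdGaussian ha) (((n : ℝ) / 2) ^ (a / 2))
  have hsub : γ.real {x | ‖x‖ ^ 2 < n / 2}ᶜ ≤ γ.real {x | ((n : ℝ) / 2) ^ (a / 2) ≤ ‖x‖ ^ a} := by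
    refine measureReal_mono fun x hx => ?_
    simp only [Set.mem_compl_iff, Set.mem_ofPred_eq, not_lt] at hx ⊢
    calc ((n : ℝ) / 2) ^ (a / 2) ≤ (‖x‖ ^ 2) ^ (a / 2) :=
          Real.rpow_le_rpow hT hx (by positivity)
      _ = ‖x‖ ^ a := by
          rw [← Real.rpow_two, ← Real.rpow_mul (norm_nonneg x)]
          congr 1
          ring
  refine le_trans ?_ hm
  rw [mul_comm]
  exact mul_le_mul_of_nonneg_left (hhalf.trans hsub) (by positivity)

theorem le_quadForm_abs_inner_rpow {E κ : Type*} [NormedAddCommGroup E] [InnerProductSpace ℝ E]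
    [Fintype κ] [DecidableEq κ] {a c N : ℝ} (ha : 0 ≤ a) (hc0 : 0 ≤ c) (hc : c ≤ 1 / 2) (hN : 0 < N)
    {z : κ → E} (hz : ∀ i, N / 2 ≤ ‖z i‖ ^ 2) {p : ℕ}
    (hA : averageTrace (centeredKernel a c (N / 2)) (p + 1) z ≤ (1 / 16) ^ (2 * (p + 1)))
    (v : κ → ℝ) :
    1 / 4 * (1 / 2) ^ a * ∑ i, v i ^ 2 ≤
      ∑ i, ∑ j, v i * |inner ℝ (z i) (z j) / N| ^ a * v j := by
  have hT : 0 < N / 2 := by positivity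
  set k := centeredKernel (E := E) a c (N / 2) with hk
  set t : κ → ℝ := fun i => (‖z i‖ / √N) ^ a with ht
  set u : κ → ℝ := fun i => v i * t i with hu
  have hz0 : ∀ i, 0 < ‖z i‖ := fun i => norm_pos_of_le_sq hT (hz i)
  have hNs : 0 < √N := Real.sqrt_pos.2 hN
  have hentry : ∀ i j, |inner ℝ (z i) (z j) / N| ^ a = t i * t j * (k (z i) (z j) + c) := by
    intro i j
    have h1 := hz0 i
    have h2 := hz0 j
    have h3 : (‖z i‖ * ‖z j‖) ^ a ≠ 0 := by positivity
    rw [hk, centeredKernel, if_pos ⟨hz i, hz j⟩, sub_add_cancel, ht]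
    simp only
    rw [← Real.mul_rpow (by positivity) (by positivity), div_mul_div_comm, Real.mul_self_sqrt hN.le,
      abs_div, abs_of_pos hN, Real.div_rpow (abs_nonneg _) hN.le,
      Real.div_rpow (by positivity) hN.le, real_inner_comm]
    field_simp
  have hdiag : ∀ i, k (z i) (z i) = 1 - c := fun i => by
    have h1 := hz0 i
    have h3 : (‖z i‖ * ‖z i‖) ^ a ≠ 0 := by positivity
    rw [hk, centeredKernel, if_pos ⟨hz i, hz i⟩, real_inner_self_eq_norm_mul_norm,
      abs_of_pos (by positivity), div_self h3]
  set Q := ∑ i, ∑ j, if i = j then 0 else u i * u j * k (z i) (z j) with hQ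
  set U := ∑ i, u i ^ 2 with hU
  have hU0 : 0 ≤ U := Finset.sum_nonneg fun i _ => sq_nonneg _
  have hQU : |Q| ≤ 1 / 4 * U := by
    refine le_of_pow_le_pow_left₀ (n := 2 * (p + 1)) (by omega) (by positivity) ?_
    rw [(even_two_mul _).pow_abs]
    calc Q ^ (2 * (p + 1)) ≤ 4 ^ (2 * (p + 1)) * averageTrace k (p + 1) z * U ^ (2 * (p + 1)) :=
          offDiag_quadForm_pow_le k z u p
      _ ≤ 4 ^ (2 * (p + 1)) * (1 / 16) ^ (2 * (p + 1)) * U ^ (2 * (p + 1)) := by gcongr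
      _ = (1 / 4 * U) ^ (2 * (p + 1)) := by
          rw [← mul_pow, ← mul_pow]
          norm_num
  have hsum : ∑ i, ∑ j, v i * |inner ℝ (z i) (z j) / N| ^ a * v j =
      (1 - c) * U + c * (∑ i, u i) ^ 2 + Q := by
    rw [sq, Finset.sum_mul_sum, hU, hQ, Finset.mul_sum, Finset.mul_sum, ← Finset.sum_add_distrib,
      ← Finset.sum_add_distrib]
    refine Finset.sum_congr rfl fun i _ => ?_
    have e : (1 - c) * u i ^ 2 = ∑ j, if i = j then (1 - c) * (u i * u j) else 0 := by
      rw [Finset.sum_ite_eq, if_pos (Finset.mem_univ i)]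
      ring
    rw [e, Finset.mul_sum, ← Finset.sum_add_distrib, ← Finset.sum_add_distrib]
    refine Finset.sum_congr rfl fun j _ => ?_
    rw [hentry]
    split_ifs with hij
    · subst hij
      rw [hdiag]
      simp only [hu]
      ring
    · simp only [hu]
      ring
  have htU : (1 / 2) ^ a * ∑ i, v i ^ 2 ≤ U := by
    rw [Finset.mul_sum]
    refine Finset.sum_le_sum fun i _ => ?_
    have h1 := hz0 i
    have h2 : (1 / 2) ^ a ≤ t i ^ 2 := by
      rw [ht]
      simp only
      rw [← Real.rpow_two, ← Real.rpow_mul (by positivity), mul_comm a 2,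
        Real.rpow_mul (by positivity), Real.rpow_two, div_pow, Real.sq_sqrt hN.le]
      refine Real.rpow_le_rpow (by norm_num) ?_ ha
      rw [le_div_iff₀ hN]
      linarith [hz i]
    simp only [hu]
    rw [mul_pow, mul_comm]
    exact mul_le_mul_of_nonneg_left h2 (sq_nonneg _)
  rw [hsum]
  have h1 := neg_abs_le Q
  have h2 : 0 ≤ c * (∑ i, u i) ^ 2 := by positivity
  nlinarith

theorem le_measureReal_norm_sq_ge_inter_averageTrace_le {n : ℕ} {κ : Type*} [Fintype κ]
    [DecidableEq κ] {a c η : ℝ}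
    (ha : 0 ≤ a) (hη : 0 < η) (p : ℕ) :
    1 - Fintype.card κ * chernoffRate ^ n - η⁻¹ *
      ∫ z : κ → EuclideanSpace ℝ (Fin n), averageTrace (centeredKernel a c (n / 2)) p z
        ∂Measure.pi (fun _ => stdGaussian (EuclideanSpace ℝ (Fin n))) ≤
    (Measure.pi fun _ : κ => stdGaussian (EuclideanSpace ℝ (Fin n))).real
      ({z | ∀ i, (n : ℝ) / 2 ≤ ‖z i‖ ^ 2} ∩
        {z | averageTrace (centeredKernel a c (n / 2)) p z ≤ η}) := by
  set γ := stdGaussian (EuclideanSpace ℝ (Fin n)) with hγ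
  set ν := Measure.pi fun _ : κ => γ with hν
  set A := fun z : κ → EuclideanSpace ℝ (Fin n) =>
    averageTrace (centeredKernel a c (n / 2)) p z with hA
  have hAm : BoundedMeasurable A :=
    (boundedMeasurable_centeredKernel ha c ((n : ℝ) / 2)).averageTrace p
  have hset : MeasurableSet ({z | ∀ i, (n : ℝ) / 2 ≤ ‖z i‖ ^ 2} ∩ {z | A z ≤ η}) :=
    (MeasurableSet.inter (by
      rw [Set.ofPred_forall]
      exact MeasurableSet.iInter fun i => measurableSet_le measurable_const (by fun_prop))
      (measurableSet_le hAm.1 measurable_const))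
  have hshort : ∀ i, ν.real {z | ‖z i‖ ^ 2 < n / 2} ≤ chernoffRate ^ n := fun i => by
    refine le_trans (le_of_eq ?_) (measureReal_norm_sq_lt_le n)
    have hs : MeasurableSet {x : EuclideanSpace ℝ (Fin n) | ‖x‖ ^ 2 < n / 2} :=
      measurableSet_lt (by fun_prop) measurable_const
    exact (measurePreserving_eval (fun _ : κ => γ) i).measureReal_preimage hs.nullMeasurableSet
  have hbig : ν.real {z | η ≤ A z} ≤ η⁻¹ * ∫ z, A z ∂ν := by
    rw [inv_mul_eq_div, le_div_iff₀' hη]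
    exact mul_meas_ge_le_integral_of_nonneg (ae_of_all _ fun z => averageTrace_nonneg _ _ _)
      (hAm.integrable _) η
  have hsub : ({z | ∀ i, (n : ℝ) / 2 ≤ ‖z i‖ ^ 2} ∩ {z | A z ≤ η})ᶜ ⊆
      (⋃ i, {z : κ → EuclideanSpace ℝ (Fin n) | ‖z i‖ ^ 2 < n / 2}) ∪ {z | η ≤ A z} := by
    intro z hz
    simp only [Set.mem_union, Set.mem_iUnion, Set.mem_ofPred_eq]
    by_contra! h
    exact hz ⟨h.1, h.2.le⟩
  have h1 : ν.real ({z | ∀ i, (n : ℝ) / 2 ≤ ‖z i‖ ^ 2} ∩ {z | A z ≤ η})ᶜ ≤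
      Fintype.card κ * chernoffRate ^ n + η⁻¹ * ∫ z, A z ∂ν := by
    refine (measureReal_mono hsub).trans ((measureReal_union_le _ _).trans (add_le_add ?_ hbig))
    refine (measureReal_iUnion_fintype_le _).trans
      ((Finset.sum_le_sum fun i _ => hshort i).trans ?_)
    simp
  rw [probReal_compl_eq_one_sub hset] at h1
  linarith

theorem le_toReal_measure_setOf_quadForm {a ε : ℝ} {n : ℕ} {Ω : Type*} [MeasurableSpace Ω]
    {μ : Measure Ω} [IsProbabilityMeasure μ] {κ : Type*} [Fintype κ] {X : Ω → Matrix κ (Fin n) ℝ}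
    (hX : μ.map (fun ω => fun p : κ × Fin n => X ω p.1 p.2) =
      Measure.pi fun _ : κ × Fin n => gaussianReal 0 1)
    {G : Set (κ → EuclideanSpace ℝ (Fin n))} (hG : MeasurableSet G)
    (h : ∀ z ∈ G, ∀ v : κ → ℝ, (∑ i, v i ^ 2) = 1 →
      ε ≤ ∑ i, ∑ j, v i * |inner ℝ (z i) (z j) / n| ^ a * v j) :
    (Measure.pi fun _ : κ => stdGaussian (EuclideanSpace ℝ (Fin n))).real G ≤
      (μ {ω | ∀ v : κ → ℝ, (∑ i, v i ^ 2) = 1 →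
        ε ≤ ∑ i, ∑ j, v i * |(∑ k, X ω i k * X ω j k) / n| ^ a * v j}).toReal := by
  set f : Ω → κ × Fin n → ℝ := fun ω p => X ω p.1 p.2 with hf
  have hfm : AEMeasurable f μ := AEMeasurable.of_map_ne_zero (by
    rw [hX]
    exact IsProbabilityMeasure.ne_zero _)
  set g : (κ × Fin n → ℝ) → κ → EuclideanSpace ℝ (Fin n) :=
    fun x i => WithLp.toLp 2 fun k => x (i, k) with hg
  have hgm : Measurable g := by fun_prop
  have hlaw : (Measure.pi fun _ : κ => stdGaussian (EuclideanSpace ℝ (Fin n))) G =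
      μ (f ⁻¹' (g ⁻¹' G)) := by
    rw [← map_pi_prod_eq_pi_stdGaussian, Measure.map_apply hgm hG, ← hX,
      Measure.map_apply_of_aemeasurable hfm (hgm hG)]
  rw [measureReal_def, hlaw]
  refine ENNReal.toReal_mono (measure_ne_top _ _) (measure_mono fun ω hω v hv => ?_)
  have := h _ hω v hv
  simpa [hg, hf, PiLp.inner_apply, mul_comm] using this

theorem tendsto_mul_mul_rpow_neg_pow {s a : ℝ} {p : ℕ} (hp : s < (a - s) * (p + 1)) :
    Tendsto (fun n : ℕ => (⌊(n : ℝ) ^ s⌋₊ : ℝ) *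
      (⌊(n : ℝ) ^ s⌋₊ * ((n : ℝ) / 2) ^ (-a)) ^ (p + 1)) atTop (nhds 0) := by
  have hlim : Tendsto (fun n : ℕ => ((1 / 2 : ℝ) ^ (-a)) ^ (p + 1) *
      (n : ℝ) ^ (-((a - s) * (p + 1) - s))) atTop (nhds 0) := by
    simpa using ((tendsto_rpow_neg_atTop (sub_pos.2 hp)).comp
      tendsto_natCast_atTop_atTop).const_mul (((1 / 2 : ℝ) ^ (-a)) ^ (p + 1))
  refine squeeze_zero' (Eventually.of_forall fun n => by positivity) ?_ hlim
  filter_upwards [eventually_gt_atTop 0] with n hn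
  have hn0 : (0 : ℝ) < n := Nat.cast_pos.2 hn
  have hfl : (⌊(n : ℝ) ^ s⌋₊ : ℝ) ≤ (n : ℝ) ^ s := Nat.floor_le (by positivity)
  calc _ ≤ (n : ℝ) ^ s * ((n : ℝ) ^ s * ((n : ℝ) / 2) ^ (-a)) ^ (p + 1) := by gcongr
    _ = _ := by
      rw [div_eq_mul_one_div, Real.mul_rpow hn0.le (by norm_num), ← mul_assoc,
        ← Real.rpow_add hn0, mul_pow, ← Real.rpow_natCast ((n : ℝ) ^ _), ← Real.rpow_mul hn0.le,
        ← mul_assoc, ← Real.rpow_add hn0, mul_comm]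
      congr 2
      push_cast
      ring

theorem gaussianAbsMoment_div_gaussianNormMoment_le {n : ℕ} (hn : 0 < n) {a : ℝ} (ha : 0 ≤ a)
    (hρ : chernoffRate ^ n ≤ 1 / 2) :
    gaussianAbsMoment a / gaussianNormMoment (EuclideanSpace ℝ (Fin n)) a ≤
      2 * gaussianAbsMoment a * ((n : ℝ) / 2) ^ (-(a / 2)) := by
  have hT : (0 : ℝ) < n / 2 := by positivity
  have h := half_mul_rpow_le_gaussianNormMoment ha hρ
  have h0 : 0 < 1 / 2 * ((n : ℝ) / 2) ^ (a / 2) := by positivity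
  rw [div_le_iff₀ (h0.trans_le h)]
  calc gaussianAbsMoment a = 2 * gaussianAbsMoment a * ((n : ℝ) / 2) ^ (-(a / 2)) *
        (1 / 2 * ((n : ℝ) / 2) ^ (a / 2)) := by
        have : ((n : ℝ) / 2) ^ (-(a / 2)) * ((n : ℝ) / 2) ^ (a / 2) = 1 := by
          rw [← Real.rpow_add hT, neg_add_cancel, Real.rpow_zero]
        linear_combination (-gaussianAbsMoment a) * this
    _ ≤ _ := by
        refine mul_le_mul_of_nonneg_left h ?_
        have := gaussianAbsMoment_nonneg a
        positivity

/-- Fix `0 < s ≤ 1` and `α > s`. Let `X_n` be `⌊n^s⌋ × n` random matrices with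
i.i.d. standard Gaussian entries, `A_n = X_n X_nᵀ / n` and `B_n = |A_n|^{∘α}`
the entrywise `α`-th absolute power. Then there exists `ε_s > 0` such that
`P(λ_min(B_n) ≥ ε_s) → 1`; the event is expressed via the variational
characterization of the smallest eigenvalue over unit vectors, so in particular
`B_n` is positive definite with high probability. -/
theorem stmt_13 (s α : ℝ) (hs0 : 0 < s) (hs1 : s ≤ 1) (hαs : s < α)
    (Ω : Type) (mΩ : MeasurableSpace Ω) (μ : Measure Ω)
    (hμ : IsProbabilityMeasure μ)
    (X : (n : ℕ) → Ω → Matrix (Fin ⌊(n : ℝ) ^ s⌋₊) (Fin n) ℝ)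
    (hX : ∀ n : ℕ, μ.map
        (fun ω => fun p : Fin ⌊(n : ℝ) ^ s⌋₊ × Fin n => X n ω p.1 p.2) =
      Measure.pi (fun _ : Fin ⌊(n : ℝ) ^ s⌋₊ × Fin n => gaussianReal 0 1)) :
    ∃ εs : ℝ, 0 < εs ∧
      Tendsto (fun n : ℕ =>
        (μ {ω | ∀ v : Fin ⌊(n : ℝ) ^ s⌋₊ → ℝ, (∑ i, v i ^ 2) = 1 →
          εs ≤ (∑ i, ∑ j, v i * |(∑ k, X n ω i k * X n ω j k) / n| ^ α * v j)}).toReal)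
        atTop (nhds 1) := by
  have hα : 0 < α := hs0.trans hαs
  obtain ⟨p, hp⟩ : ∃ p : ℕ, s < (α - s) * (p + 1) := by
    obtain ⟨p, hp⟩ := exists_nat_gt (s / (α - s))
    rw [div_lt_iff₀' (sub_pos.2 hαs)] at hp
    exact ⟨p, hp.trans_le (by nlinarith)⟩
  set c := gaussianAbsMoment α with hc
  have hc0 : 0 ≤ c := gaussianAbsMoment_nonneg α
  set K := (2 * c) ^ 2 with hK
  have hK0 : 0 ≤ K := sq_nonneg _
  set g := gaussianAbsMoment (4 * (p + 1 : ℕ)) with hg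
  have hg0 : 0 ≤ g := gaussianAbsMoment_nonneg _
  have hD := traceMomentConst_nonneg hα.le hK0 (p + 1)
  set D := traceMomentConst α K (p + 1) with hDdef
  set C := D * (2 ^ p * (2 ^ (p + 1) + 4 ^ (p + 1) * g)) with hC
  set η : ℝ := (1 / 16) ^ (2 * (p + 1)) with hη
  have hη0 : 0 < η := by positivity
  set m : ℕ → ℝ := fun n => ⌊(n : ℝ) ^ s⌋₊ with hm
  refine ⟨1 / 4 * (1 / 2) ^ α, by positivity, ?_⟩
  have hlow : Tendsto (fun n : ℕ => 1 - n * chernoffRate ^ n -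
      η⁻¹ * (C * (m n * (m n * ((n : ℝ) / 2) ^ (-α)) ^ (p + 1)))) atTop (nhds 1) := by
    have h1 := tendsto_self_mul_const_pow_of_lt_one chernoffRate_pos.le chernoffRate_lt_one
    have h2 := ((tendsto_mul_mul_rpow_neg_pow hp).const_mul C).const_mul η⁻¹
    simpa using (h1.const_sub 1).sub h2
  have hρ : ∀ᶠ n : ℕ in atTop, chernoffRate ^ n ≤ 1 / 2 :=
    (tendsto_pow_atTop_nhds_zero_of_lt_one chernoffRate_pos.le
      chernoffRate_lt_one).eventually_le_const (by norm_num)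
  have hκ : ∀ᶠ n : ℕ in atTop, 2 * c * ((n : ℝ) / 2) ^ (-(α / 2)) ≤ 1 / 2 := by
    have h1 : Tendsto (fun n : ℕ => (n : ℝ) / 2) atTop atTop :=
      tendsto_natCast_atTop_atTop.atTop_div_const two_pos
    have h2 := ((tendsto_rpow_neg_atTop (half_pos hα)).comp h1).const_mul (2 * c)
    rw [mul_zero] at h2
    exact h2.eventually_le_const (by norm_num)
  refine tendsto_of_tendsto_of_tendsto_of_le_of_le' hlow tendsto_const_nhds ?_
    (Eventually.of_forall fun n => ENNReal.toReal_le_of_le_ofReal zero_le_one (by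
      simpa using prob_le_one))
  filter_upwards [hρ, hκ, eventually_gt_atTop 0] with n hρ hκ hn
  have hn0 : (0 : ℝ) < n := Nat.cast_pos.2 hn
  have hT : (0 : ℝ) < n / 2 := by positivity
  have hR : 0 < gaussianNormMoment (EuclideanSpace ℝ (Fin n)) α :=
    lt_of_lt_of_le (by positivity) (half_mul_rpow_le_gaussianNormMoment hα.le hρ)
  have hκle := gaussianAbsMoment_div_gaussianNormMoment_le hn hα.le hρ
  rw [← hc] at hκle
  set κ := c / gaussianNormMoment (EuclideanSpace ℝ (Fin n)) α with hκdef
  have hκ0 : 0 ≤ κ := div_nonneg hc0 hR.le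
  have hκ2 : κ ^ 2 ≤ K * ((n : ℝ) / 2) ^ (-α) := by
    refine (pow_le_pow_left₀ hκ0 hκle 2).trans (le_of_eq ?_)
    rw [mul_pow, ← Real.rpow_two (_ ^ _), ← Real.rpow_mul hT.le]
    congr 2
    ring
  have hm1 : m n ≤ n := by
    refine (Nat.floor_le (by positivity)).trans ?_
    conv_rhs => rw [← Real.rpow_one (n : ℝ)]
    exact Real.rpow_le_rpow_of_exponent_le (by exact_mod_cast hn) hs1
  have hm0 : 0 ≤ m n := Nat.cast_nonneg _
  have hAm := (boundedMeasurable_centeredKernel (E := EuclideanSpace ℝ (Fin n)) hα.le κ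
    ((n : ℝ) / 2)).averageTrace (κ := Fin ⌊(n : ℝ) ^ s⌋₊) (p + 1)
  have htr := integral_averageTrace_centeredKernel_le (κ := Fin ⌊(n : ℝ) ^ s⌋₊) hα hR hT hK0 hκ2 p
  have hprob := le_measureReal_norm_sq_ge_inter_averageTrace_le (n := n)
    (κ := Fin ⌊(n : ℝ) ^ s⌋₊) (c := κ) hα.le hη0 (p + 1)
  refine le_trans ?_ (hprob.trans (le_toReal_measure_setOf_quadForm (hX n) ?_ ?_))
  · rw [Fintype.card_fin]
    rw [Fintype.card_fin] at htr
    refine sub_le_sub (sub_le_sub_left (mul_le_mul_of_nonneg_right hm1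
      (pow_nonneg chernoffRate_pos.le n)) 1) (mul_le_mul_of_nonneg_left (htr.trans ?_)
      (by positivity))
    have h4 : (m n ^ 2 / ((n : ℝ) / 2) ^ 2) ^ (p + 1) ≤ 4 ^ (p + 1) := by
      refine pow_le_pow_left₀ (by positivity) ?_ _
      rw [div_le_iff₀ (by positivity)]
      nlinarith
    calc _ ≤ D * m n * (m n * ((n : ℝ) / 2) ^ (-α)) ^ (p + 1) *
          (2 ^ p * (2 ^ (p + 1) + 4 ^ (p + 1) * g)) := by
          gcongr
      _ = _ := by
          rw [hC]
          ring
  · refine MeasurableSet.inter ?_ (measurableSet_le hAm.1 measurable_const)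
    rw [Set.ofPred_forall]
    exact MeasurableSet.iInter fun i => measurableSet_le measurable_const (by fun_prop)
  · intro z hz v hv
    have := le_quadForm_abs_inner_rpow hα.le hκ0 (hκle.trans hκ) hn0 hz.1 hz.2 v
    rwa [hv, mul_one] at this
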